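/- arXiv:1904.12768 — 2 statements merged into one kernel-verified Lean document; each statement's English description precedes it below -/
import Mathlib

section
/- In the data-market game with unbounded effort (ℰ_s = [0,∞) and 𝒜_s = [𝒂̲_s, ∞) for every s), suppose 𝛄_s ≥ 𝒂̲_s for every s and γ_i^j > 0 for all i ∈ {1,…,N} and j ∈ {1,…,M}. Then there exists a generalized Nash equilibrium (c,a) whose induced effort profile (μ_s(𝒂_s))_{s=1}^N has price of anarchy equal to 1 (i.e., minimizes the ex-ante social cost 𝓛(e) = Σ_s 𝛄_s·σ_s(e_s)² + Σ_s e_s over [0,∞)^N) if and only if ξ_{i,l}^j = 0 for every j ∈ {1,…,M} and every i, l ∈ {1,…,N} with i ≠ l. -/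
/-- The (within-`[0,∞)`) derivative of `σ`. -/
noncomputable def sigd (σ : ℝ → ℝ) : ℝ → ℝ := derivWithin σ (Set.Ici 0)

/-- `𝒂̲ = -1/(2 σ(0) σ'(0))`. -/
noncomputable def alow (σ : ℝ → ℝ) : ℝ := -1 / (2 * σ 0 * sigd σ 0)

/-- Assumption 3 of the paper: `σ` is positive, strictly decreasing, convex and C² on `[0,∞)`. -/
def SigmaOK (σ : ℝ → ℝ) : Prop :=
  (∀ e ∈ Set.Ici (0:ℝ), 0 < σ e) ∧ StrictAntiOn σ (Set.Ici 0) ∧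
    ConvexOn ℝ (Set.Ici 0) σ ∧ ContDiffOn ℝ 2 σ (Set.Ici 0)

/-- `m` is the unique maximizer of `f` on `S`. -/
def UniqueMaxOn (f : ℝ → ℝ) (S : Set ℝ) (m : ℝ) : Prop :=
  m ∈ S ∧ (∀ e ∈ S, f e ≤ f m) ∧ ∀ e ∈ S, (∀ e' ∈ S, f e' ≤ f e) → e = m

variable {N M : ℕ}

/-- `𝒂_s = Σ_j a_s^j`, the total quadratic-penalty weight offered to source `s`. -/
noncomputable def boldA (a : Fin M → Fin N → ℝ) (s : Fin N) : ℝ := ∑ j, a j s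

/-- `σ_i(μ_i(𝒂_i))²`, the equilibrium variance of source `i`'s data. -/
noncomputable def Vval (σ μ : Fin N → ℝ → ℝ) (a : Fin M → Fin N → ℝ) (i : Fin N) : ℝ :=
  σ i (μ i (boldA a i)) ^ 2

/-- `q_s^b(a) = a_s^b Σ_i ξ_{s,i}^b σ_i(μ_i(𝒂_i))²`. -/
noncomputable def qb (σ μ : Fin N → ℝ → ℝ) (ξ : Fin M → Fin N → Fin N → ℝ)
    (a : Fin M → Fin N → ℝ) (b : Fin M) (s : Fin N) : ℝ :=
  a b s * ∑ i, ξ b s i * Vval σ μ a i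

/-- `q_s(a) = Σ_j q_s^j(a) + μ_s(𝒂_s)`. -/
noncomputable def qtot (σ μ : Fin N → ℝ → ℝ) (ξ : Fin M → Fin N → Fin N → ℝ)
    (a : Fin M → Fin N → ℝ) (s : Fin N) : ℝ :=
  (∑ j, qb σ μ ξ a j s) + μ s (boldA a s)

/-- Aggregator `b`'s loss `L^b`. -/
noncomputable def Lagg (σ μ : Fin N → ℝ → ℝ) (ξ : Fin M → Fin N → Fin N → ℝ)
    (γ : Fin M → Fin N → ℝ) (c a : Fin M → Fin N → ℝ) (b : Fin M) : ℝ :=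
  (∑ i, γ b i * Vval σ μ a i) +
    ∑ i, (c b i - a b i * ∑ l, ξ b i l * Vval σ μ a l)

/-- Feasibility of `(c^b, a^b)` for aggregator `b` within the profile `(c,a)`:
nonnegative weights, `𝒂_s ∈ 𝒜_s`, individual rationality and nonnegative expected payments. -/
def Feasible (σ μ : Fin N → ℝ → ℝ) (ξ : Fin M → Fin N → Fin N → ℝ)
    (𝒜 : Fin N → Set ℝ) (c a : Fin M → Fin N → ℝ) (b : Fin M) : Prop :=
  ∀ s, 0 ≤ a b s ∧ boldA a s ∈ 𝒜 s ∧
    μ s (boldA a s) ≤ (∑ j, c j s) - ∑ j, qb σ μ ξ a j s ∧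
    0 ≤ c b s - qb σ μ ξ a b s

/-- Generalized Nash equilibrium of the game between the aggregators. -/
def IsGNE (σ μ : Fin N → ℝ → ℝ) (ξ : Fin M → Fin N → Fin N → ℝ)
    (γ : Fin M → Fin N → ℝ) (𝒜 : Fin N → Set ℝ) (c a : Fin M → Fin N → ℝ) : Prop :=
  (∀ b, Feasible σ μ ξ 𝒜 c a b) ∧
    ∀ b (c' a' : Fin N → ℝ),
      Feasible σ μ ξ 𝒜 (Function.update c b c') (Function.update a b a') b →
      Lagg σ μ ξ γ c a b ≤ Lagg σ μ ξ γ (Function.update c b c') (Function.update a b a') b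

/-- The ex-ante social cost `𝓛(e) = Σ_s 𝛄_s σ_s(e_s)² + Σ_s e_s`. -/
noncomputable def SC (Γ : Fin N → ℝ) (σ : Fin N → ℝ → ℝ) (e : Fin N → ℝ) : ℝ :=
  (∑ s, Γ s * σ s (e s) ^ 2) + ∑ s, e s

section Source

variable {σ μ : ℝ → ℝ}

/-- The penalty weight under which the effort `e` is optimal for a source. -/
noncomputable def effortWeight (σ : ℝ → ℝ) (e : ℝ) : ℝ := -1 / (2 * σ e * sigd σ e)

theorem SigmaOK.hasDerivWithinAt (h : SigmaOK σ) {e : ℝ} (he : 0 ≤ e) :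
    HasDerivWithinAt σ (sigd σ e) (Set.Ici 0) e :=
  (h.2.2.2.differentiableOn (by norm_num) e he).hasDerivWithinAt

theorem SigmaOK.tangent_le (h : SigmaOK σ) {e y : ℝ} (he : 0 ≤ e) (hy : 0 ≤ y) :
    σ e + sigd σ e * (y - e) ≤ σ y := by
  rcases lt_trichotomy e y with hlt | rfl | hlt
  · have := h.2.2.1.le_slope_of_hasDerivWithinAt he hy hlt (h.hasDerivWithinAt he)
    rw [slope_def_field, le_div_iff₀ (sub_pos.2 hlt)] at this
    linarith
  · simp
  · have := h.2.2.1.slope_le_of_hasDerivWithinAt hy he hlt (h.hasDerivWithinAt he)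
    rw [slope_def_field, div_le_iff₀ (sub_pos.2 hlt)] at this
    linarith

theorem SigmaOK.sigd_neg (h : SigmaOK σ) {e : ℝ} (he : 0 ≤ e) : sigd σ e < 0 := by
  have h1 := h.tangent_le he (by linarith : (0 : ℝ) ≤ e + 1)
  have h2 := h.2.1 he (by simp; linarith : e + 1 ∈ Set.Ici (0 : ℝ)) (by linarith)
  linarith

theorem SigmaOK.mul_sigd_neg (h : SigmaOK σ) {e : ℝ} (he : 0 ≤ e) :
    2 * σ e * sigd σ e < 0 :=
  mul_neg_of_pos_of_neg (mul_pos two_pos (h.1 e he)) (h.sigd_neg he)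

theorem SigmaOK.effortWeight_pos (h : SigmaOK σ) {e : ℝ} (he : 0 ≤ e) :
    0 < effortWeight σ e :=
  div_pos_of_neg_of_neg (by norm_num) (h.mul_sigd_neg he)

theorem SigmaOK.alow_pos (h : SigmaOK σ) : 0 < alow σ := h.effortWeight_pos le_rfl

theorem SigmaOK.effortWeight_mul (h : SigmaOK σ) {e : ℝ} (he : 0 ≤ e) :
    effortWeight σ e * (2 * σ e * sigd σ e) = -1 :=
  div_mul_cancel₀ _ (h.mul_sigd_neg he).ne

theorem SigmaOK.continuousOn (h : SigmaOK σ) : ContinuousOn σ (Set.Ici 0) :=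
  h.2.2.2.continuousOn

theorem SigmaOK.continuousOn_effortWeight (h : SigmaOK σ) :
    ContinuousOn (effortWeight σ) (Set.Ici 0) := by
  have hd : ContinuousOn (sigd σ) (Set.Ici 0) :=
    h.2.2.2.continuousOn_derivWithin (uniqueDiffOn_Ici 0) (by norm_num)
  exact continuousOn_const.div ((continuousOn_const.mul h.continuousOn).mul hd)
    fun e he => (h.mul_sigd_neg he).ne

theorem SigmaOK.sq_lt_sq (h : SigmaOK σ) {e y : ℝ} (he : 0 ≤ e) (hey : e < y) :
    σ y ^ 2 < σ e ^ 2 :=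
  pow_lt_pow_left₀ (h.2.1 he (he.trans hey.le) hey) (h.1 y (he.trans hey.le)).le two_ne_zero

/-- Every effort is optimal under its weight. -/
theorem SigmaOK.maximizer_effortWeight (h : SigmaOK σ)
    (hμ : ∀ a : ℝ, 0 < a → UniqueMaxOn (fun e => -a * σ e ^ 2 - e) (Set.Ici 0) (μ a))
    {e : ℝ} (he : 0 ≤ e) : μ (effortWeight σ e) = e := by
  refine ((hμ _ (h.effortWeight_pos he)).2.2 e he fun y hy => ?_).symm
  have hA := h.effortWeight_pos he
  have ht := h.tangent_le he hy
  have hs : σ e ^ 2 + 2 * σ e * sigd σ e * (y - e) ≤ σ y ^ 2 := by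
    nlinarith [sq_nonneg (σ y - σ e), mul_le_mul_of_nonneg_left ht (h.1 e he).le]
  have hm := mul_le_mul_of_nonneg_left hs hA.le
  have hw : effortWeight σ e * (2 * σ e * sigd σ e * (y - e)) = -(y - e) := by
    rw [← mul_assoc, h.effortWeight_mul he]; ring
  simp only
  linarith

/-- First-order condition for the source's effort choice. -/
theorem SigmaOK.effortWeight_maximizer (h : SigmaOK σ)
    (hμ : ∀ a : ℝ, 0 < a → UniqueMaxOn (fun e => -a * σ e ^ 2 - e) (Set.Ici 0) (μ a))
    {a : ℝ} (ha : alow σ ≤ a) : effortWeight σ (μ a) = a := by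
  obtain ⟨hm0, hmax, -⟩ := hμ a (h.alow_pos.trans_le ha)
  have hder : HasDerivWithinAt (fun e => -a * σ e ^ 2 - e)
      (-a * (2 * σ (μ a) * sigd σ (μ a)) - 1) (Set.Ici 0) (μ a) := by
    refine (((h.hasDerivWithinAt hm0).pow 2).const_mul (-a)).sub (hasDerivWithinAt_id _ _)
      |>.congr_deriv ?_
    simp
  have hneg := h.mul_sigd_neg hm0
  have hmon : IsMaxOn (fun e => -a * σ e ^ 2 - e) (Set.Ici 0) (μ a) := hmax
  have hfoc : -a * (2 * σ (μ a) * sigd σ (μ a)) - 1 = 0 := by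
    rcases (show (0 : ℝ) ≤ μ a from hm0).eq_or_lt with h0 | hpos
    · have h1 : (1 : ℝ) ∈ posTangentConeAt (Set.Ici 0) (μ a) := by
        apply mem_posTangentConeAt_of_segment_subset
        rw [segment_eq_Icc (by linarith)]
        exact fun y hy => le_trans hm0 hy.1
      have hle := hmon.localize.hasFDerivWithinAt_nonpos hder.hasFDerivWithinAt h1
      simp only [ContinuousLinearMap.toSpanSingleton_apply, one_smul] at hle
      refine le_antisymm hle ?_
      have h2 := mul_le_mul_of_nonpos_right ha hneg.le
      have h3 : alow σ * (2 * σ (μ a) * sigd σ (μ a)) = -1 := by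
        rw [← h0]; exact h.effortWeight_mul le_rfl
      linarith
    · have hn : Set.Ici (0 : ℝ) ∈ nhds (μ a) := Ici_mem_nhds hpos
      exact (hmon.isLocalMax hn).hasDerivAt_eq_zero (hder.hasDerivAt hn)
  rw [effortWeight, div_eq_iff hneg.ne]
  linarith

/-- Every small enough decrease of the variance is induced by a small increase of the weight. -/
theorem SigmaOK.exists_weight_increase (h : SigmaOK σ)
    (hμ : ∀ a : ℝ, 0 < a → UniqueMaxOn (fun e => -a * σ e ^ 2 - e) (Set.Ici 0) (μ a))
    {a : ℝ} (ha : alow σ ≤ a) {ε : ℝ} (hε : 0 < ε) :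
    ∃ T > 0, ∀ t, 0 < t → t ≤ T →
      ∃ d, 0 ≤ d ∧ d ≤ ε ∧ σ (μ (a + d)) ^ 2 = σ (μ a) ^ 2 - t := by
  have ha0 := h.alow_pos.trans_le ha
  have hm0 : 0 ≤ μ a := (hμ a ha0).1
  have hfoc := h.effortWeight_maximizer hμ ha
  obtain ⟨δ, hδ, hclose⟩ :=
    Metric.continuousWithinAt_iff.1 (h.continuousOn_effortWeight (μ a) hm0) ε hε
  refine ⟨σ (μ a) ^ 2 - σ (μ a + δ / 2) ^ 2, sub_pos.2 (h.sq_lt_sq hm0 (by linarith)),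
    fun t ht htT => ?_⟩
  have hcont : ContinuousOn (fun e => σ e ^ 2) (Set.Icc (μ a) (μ a + δ / 2)) :=
    (h.continuousOn.pow 2).mono fun e he => hm0.trans he.1
  obtain ⟨e, he, het⟩ := intermediate_value_Icc' (by linarith) hcont
    (show σ (μ a) ^ 2 - t ∈ Set.Icc (σ (μ a + δ / 2) ^ 2) (σ (μ a) ^ 2) from
      ⟨by linarith, by linarith⟩)
  have he0 : 0 ≤ e := hm0.trans he.1
  have hμe := h.maximizer_effortWeight hμ he0
  have hd := hclose (x := e) he0 (by
    rw [Real.dist_eq, abs_of_nonneg (by linarith [he.1])]; linarith [he.2])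
  rw [Real.dist_eq, hfoc] at hd
  refine ⟨effortWeight σ e - a, ?_, (le_abs_self _).trans hd.le, ?_⟩
  · by_contra! hlt
    have hW := h.effortWeight_pos he0
    have h1 := (hμ _ hW).2.1 _ hm0
    have h2 := (hμ a ha0).2.1 e he0
    rw [hμe] at h1
    simp only at h1 h2 het
    nlinarith
  · rw [add_sub_cancel, hμe]
    exact het

end Source

section Game

variable {σ μ : Fin N → ℝ → ℝ} {ξ : Fin M → Fin N → Fin N → ℝ} {γ : Fin M → Fin N → ℝ}
  {c a : Fin M → Fin N → ℝ}

/-- A source prefers its effort under the weight `A'` to its effort under `A`. -/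
theorem maximizer_cost_le {σ μ : ℝ → ℝ}
    (hμ : ∀ a : ℝ, 0 < a → UniqueMaxOn (fun e => -a * σ e ^ 2 - e) (Set.Ici 0) (μ a))
    {A A' : ℝ} (hA : 0 < A) (hA' : 0 < A') :
    A' * σ (μ A') ^ 2 + μ A' ≤ A' * σ (μ A) ^ 2 + μ A := by
  have := (hμ A' hA').2.1 (μ A) (hμ A hA).1
  simp only at this
  linarith

theorem boldA_update (a : Fin M → Fin N → ℝ) (b : Fin M) (v : Fin N → ℝ) (s : Fin N) :
    boldA (Function.update a b v) s = v s + ∑ j ∈ Finset.univ.erase b, a j s := by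
  rw [boldA, ← Finset.add_sum_erase _ _ (Finset.mem_univ b), Function.update_self]
  congr 1
  exact Finset.sum_congr rfl fun j hj => by
    rw [Function.update_of_ne (Finset.ne_of_mem_erase hj)]

theorem boldA_eq_add_erase (a : Fin M → Fin N → ℝ) (b : Fin M) (s : Fin N) :
    boldA a s = a b s + ∑ j ∈ Finset.univ.erase b, a j s :=
  (Finset.add_sum_erase _ (fun j => a j s) (Finset.mem_univ b)).symm

/-- Necessary condition for equilibrium: the deviation of aggregator `b` which raises its weights
by `d`, lowers the variances by `x`, and keeps the individual rationality constraints satisfied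
is not profitable. -/
theorem IsGNE.sum_le_sum_max (hσ : ∀ s, SigmaOK (σ s))
    (hμ : ∀ s, ∀ a : ℝ, 0 < a →
      UniqueMaxOn (fun e => -a * σ s e ^ 2 - e) (Set.Ici 0) (μ s a))
    (h : IsGNE σ μ ξ γ (fun s => Set.Ici (alow (σ s))) c a) (b : Fin M) {d x : Fin N → ℝ}
    (hd : ∀ s, 0 ≤ d s)
    (hx : ∀ s, σ s (μ s (boldA a s + d s)) ^ 2 = σ s (μ s (boldA a s)) ^ 2 - x s) :
    ∑ s, γ b s * x s ≤ ∑ s, max 0 ((boldA a s + d s) * x s -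
      ∑ j ∈ Finset.univ.erase b, a j s * ∑ l, ξ j s l * x l) := by
  set a' : Fin M → Fin N → ℝ := Function.update a b fun s => a b s + d s with ha'
  set R : Fin N → ℝ := fun s => ∑ j ∈ Finset.univ.erase b, a j s * ∑ l, ξ j s l * x l with hR
  set y : Fin N → ℝ := fun s => max 0 ((boldA a s + d s) * x s - R s) with hy
  set c' : Fin N → ℝ := fun s => c b s - qb σ μ ξ a b s + y s + qb σ μ ξ a' b s with hc'
  have hA : ∀ s, boldA a' s = boldA a s + d s := fun s => by
    rw [ha', boldA_update, boldA_eq_add_erase a b]; ring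
  have hV : ∀ s, Vval σ μ a' s = Vval σ μ a s - x s := fun s => by
    rw [Vval, hA, hx, Vval]
  have hq : ∀ s, ∀ j ∈ Finset.univ.erase b,
      qb σ μ ξ a' j s = qb σ μ ξ a j s - a j s * ∑ l, ξ j s l * x l := fun s j hj => by
    simp only [qb, hV, mul_sub, Finset.sum_sub_distrib]
    rw [ha', Function.update_of_ne (Finset.ne_of_mem_erase hj)]
  have hfeas : Feasible σ μ ξ (fun s => Set.Ici (alow (σ s))) (Function.update c b c') a' b := by
    intro s
    obtain ⟨h1, h2, h3, h4⟩ := h.1 b s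
    have h2' : alow (σ s) ≤ boldA a s := h2
    have hpos : 0 < boldA a s := (hσ s).alow_pos.trans_le h2'
    refine ⟨?_, ?_, ?_, ?_⟩
    · rw [ha', Function.update_self]
      exact add_nonneg h1 (hd s)
    · rw [hA]
      exact h2'.trans (le_add_of_nonneg_right (hd s))
    · have hcost := maximizer_cost_le (hμ s) hpos (add_pos_of_pos_of_nonneg hpos (hd s))
      rw [hx] at hcost
      have hc : ∑ j, Function.update c b c' j s = c' s + ∑ j ∈ Finset.univ.erase b, c j s :=
        boldA_update c b c' s
      rw [hA, hc, ← Finset.add_sum_erase _ (fun j => qb σ μ ξ a' j s) (Finset.mem_univ b),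
        Finset.sum_congr rfl (hq s), Finset.sum_sub_distrib]
      rw [← Finset.add_sum_erase _ (fun j => qb σ μ ξ a j s) (Finset.mem_univ b),
        ← Finset.add_sum_erase _ (fun j => c j s) (Finset.mem_univ b)] at h3
      have hys : (boldA a s + d s) * x s - R s ≤ y s := le_max_right _ _
      simp only [hR] at hys
      simp only [hc']
      linarith
    · rw [Function.update_self]
      have hys : 0 ≤ y s := le_max_left _ _
      simp only [hc']
      linarith
  have hL := h.2 b c' (fun s => a b s + d s) hfeas
  have e1 : Lagg σ μ ξ γ c a b =
      (∑ i, γ b i * Vval σ μ a i) + ∑ i, (c b i - qb σ μ ξ a b i) := rfl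
  have e2 : Lagg σ μ ξ γ (Function.update c b c') a' b =
      (∑ i, γ b i * Vval σ μ a i) - (∑ i, γ b i * x i) +
        (∑ i, (c b i - qb σ μ ξ a b i) + ∑ i, y i) := by
    rw [← Finset.sum_sub_distrib, ← Finset.sum_add_distrib]
    change _ + ∑ i, (Function.update c b c' b i - qb σ μ ξ a' b i) = _
    rw [Function.update_self]
    congr 1
    · exact Finset.sum_congr rfl fun i _ => by rw [hV]; ring
    · exact Finset.sum_congr rfl fun i _ => by simp only [hc']; ring
  rw [e1, e2] at hL
  linarith

/-- At an equilibrium, each weight is at least the aggregator's demand. -/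
theorem IsGNE.demand_le (hσ : ∀ s, SigmaOK (σ s))
    (hμ : ∀ s, ∀ a : ℝ, 0 < a →
      UniqueMaxOn (fun e => -a * σ s e ^ 2 - e) (Set.Ici 0) (μ s a))
    (hξ0 : ∀ b i l, 0 ≤ ξ b i l) (hξ1 : ∀ b i, ξ b i i = 1)
    (h : IsGNE σ μ ξ γ (fun s => Set.Ici (alow (σ s))) c a) (b : Fin M) (s : Fin N) :
    γ b s ≤ a b s := by
  have ha0 : ∀ j i, 0 ≤ a j i := fun j i => (h.1 j i).1
  refine le_of_forall_pos_le_add fun ε hε => ?_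
  obtain ⟨t, ht, hex⟩ := (hσ s).exists_weight_increase (hμ s) (h.1 b s).2.1 hε
  obtain ⟨d, hd0, hdε, hdt⟩ := hex t ht le_rfl
  have key := h.sum_le_sum_max hσ hμ b (d := Pi.single s d) (x := Pi.single s t)
    (fun i => by
      rcases eq_or_ne i s with rfl | hi
      · simpa using hd0
      · simp [hi])
    (fun i => by
      rcases eq_or_ne i s with rfl | hi
      · simpa using hdt
      · simp [hi])
  have hl : ∑ i, γ b i * (Pi.single s t : Fin N → ℝ) i = γ b s * t := by
    simp [Pi.single_apply]
  have hr : ∀ j i, ∑ l, ξ j i l * (Pi.single s t : Fin N → ℝ) l = ξ j i s * t := fun j i => by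
    simp [Pi.single_apply]
  rw [hl, Finset.sum_eq_single s] at key
  · simp only [hr, hξ1, Pi.single_eq_same, one_mul, ← Finset.sum_mul,
      boldA_eq_add_erase a b] at key
    rw [max_eq_right] at key
    · nlinarith
    · nlinarith [mul_nonneg (add_nonneg (ha0 b s) hd0) ht.le]
  · intro i _ hi
    simp only [hr, Pi.single_eq_of_ne hi, mul_zero, zero_sub]
    exact max_eq_left (neg_nonpos.2 (Finset.sum_nonneg fun j _ =>
      mul_nonneg (ha0 j i) (mul_nonneg (hξ0 j i s) ht.le)))
  · simp

/-- A socially optimal equilibrium is incompatible with payment coupling. -/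
theorem IsGNE.coupling_eq_zero (hM : 2 ≤ M) (hσ : ∀ s, SigmaOK (σ s))
    (hμ : ∀ s, ∀ a : ℝ, 0 < a →
      UniqueMaxOn (fun e => -a * σ s e ^ 2 - e) (Set.Ici 0) (μ s a))
    (hξ0 : ∀ b i l, 0 ≤ ξ b i l) (hξ1 : ∀ b i, ξ b i i = 1) (hγ : ∀ b i, 0 < γ b i)
    (h : IsGNE σ μ ξ γ (fun s => Set.Ici (alow (σ s))) c a)
    (hA : ∀ s, boldA a s = ∑ j, γ j s) {j : Fin M} {i l : Fin N} (hil : i ≠ l) :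
    ξ j i l = 0 := by
  have haγ : a = γ := by
    funext b s
    exact ((Finset.sum_eq_sum_iff_of_le fun b _ => h.demand_le hσ hμ hξ0 hξ1 b s).1
      (hA s).symm b (Finset.mem_univ b)).symm
  subst haγ
  by_contra hne
  have hpos : 0 < ξ j i l := (hξ0 j i l).lt_of_ne' hne
  have : Nontrivial (Fin M) := Fin.nontrivial_iff_two_le.2 hM
  obtain ⟨b, hb⟩ := exists_ne j
  set η : ℝ := min (a j i * ξ j i l) (a b i) with hη
  have hη0 : 0 < η := lt_min (mul_pos (hγ j i) hpos) (hγ b i)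
  set ε : ℝ := η / (N + 1) with hε
  have hN0 : (0 : ℝ) < N + 1 := by positivity
  have hε0 : 0 < ε := div_pos hη0 hN0
  choose T hT hex using fun s => (hσ s).exists_weight_increase (hμ s) (h.1 b s).2.1 hε0
  have hne : (Finset.univ : Finset (Fin N)).Nonempty := ⟨i, Finset.mem_univ i⟩
  set t : ℝ := Finset.univ.inf' hne T with ht
  have ht0 : 0 < t := (Finset.lt_inf'_iff hne).2 fun s _ => hT s
  choose d hd0 hdε hdt using fun s => hex s t ht0 (Finset.inf'_le T (Finset.mem_univ s))
  have key := h.sum_le_sum_max hσ hμ b (x := fun _ => t) hd0 hdt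
  have hrow : ∀ k s, 1 ≤ ∑ m, ξ k s m := fun k s =>
    (hξ1 k s).symm.le.trans
      (Finset.single_le_sum (f := ξ k s) (fun m _ => hξ0 k s m) (Finset.mem_univ s))
  have hrow' : 1 + ξ j i l ≤ ∑ m, ξ j i m := by
    rw [← Finset.add_sum_erase _ _ (Finset.mem_univ i), hξ1]
    gcongr
    exact Finset.single_le_sum (f := ξ j i) (fun m _ => hξ0 j i m)
      (Finset.mem_erase.2 ⟨hil.symm, Finset.mem_univ l⟩)
  have hterm : ∀ s, max 0 ((boldA a s + d s) * t -
      ∑ k ∈ Finset.univ.erase b, a k s * ∑ m, ξ k s m * t) ≤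
      (a b s + ε - if s = i then η else 0) * t := by
    intro s
    have hsum : ∑ k ∈ Finset.univ.erase b, a k s + (if s = i then η else 0) ≤
        ∑ k ∈ Finset.univ.erase b, a k s * ∑ m, ξ k s m := by
      have hle : ∀ k ∈ Finset.univ.erase b, a k s + (if k = j then if s = i then η else 0 else 0)
          ≤ a k s * ∑ m, ξ k s m := by
        intro k _
        have h1 := mul_le_mul_of_nonneg_left (hrow k s) (hγ k s).le
        split_ifs with hk hs
        · subst hk hs
          have h2 := mul_le_mul_of_nonneg_left hrow' (hγ k s).le
          have h3 : η ≤ a k s * ξ k s l := min_le_left _ _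
          linarith
        · linarith
        · linarith
      refine le_trans (le_of_eq ?_) (Finset.sum_le_sum hle)
      rw [Finset.sum_add_distrib, Finset.sum_ite_eq',
        if_pos (Finset.mem_erase.2 ⟨hb.symm, Finset.mem_univ j⟩)]
    refine max_le (mul_nonneg ?_ ht0.le) ?_
    · split_ifs with hs
      · subst hs
        have : η ≤ a b s := min_le_right _ _
        linarith
      · linarith [hγ b s]
    · simp only [← Finset.sum_mul, ← mul_assoc]
      rw [← sub_mul, boldA_eq_add_erase a b]
      refine mul_le_mul_of_nonneg_right ?_ ht0.le
      linarith [hdε s]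
  have hfin := key.trans (Finset.sum_le_sum fun s _ => hterm s)
  rw [← Finset.sum_mul, ← Finset.sum_mul, Finset.sum_sub_distrib, Finset.sum_add_distrib] at hfin
  simp only [Finset.sum_ite_eq', Finset.mem_univ, if_true, Finset.sum_const, Finset.card_univ,
    Fintype.card_fin, nsmul_eq_mul] at hfin
  have hle := le_of_mul_le_mul_right hfin ht0
  have hmul : ε * (N + 1) = η := div_mul_cancel₀ _ hN0.ne'
  linarith

/-- Without payment coupling, weights equal to the demands form an equilibrium. -/
theorem isGNE_of_uncoupled (hM : 2 ≤ M) (hσ : ∀ s, SigmaOK (σ s))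
    (hμ : ∀ s, ∀ a : ℝ, 0 < a →
      UniqueMaxOn (fun e => -a * σ s e ^ 2 - e) (Set.Ici 0) (μ s a))
    (hξ1 : ∀ b i, ξ b i i = 1) (hγ : ∀ b i, 0 < γ b i)
    (hΓ : ∀ s, alow (σ s) ≤ ∑ j, γ j s) (hξ : ∀ j i l, i ≠ l → ξ j i l = 0) :
    IsGNE σ μ ξ γ (fun s => Set.Ici (alow (σ s)))
      (fun b s => qb σ μ ξ γ b s + μ s (boldA γ s) / M) γ := by
  have hrow : ∀ (v : Fin N → ℝ) j s, ∑ l, ξ j s l * v l = v s := fun v j s => by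
    rw [Finset.sum_eq_single s (fun l _ hl => by rw [hξ j s l hl.symm, zero_mul]) (by simp),
      hξ1, one_mul]
  have hM0 : (0 : ℝ) < M := by exact_mod_cast two_pos.trans_le hM
  have hpos : ∀ s, 0 < boldA γ s := fun s => (hσ s).alow_pos.trans_le (hΓ s)
  have hμ0 : ∀ s, 0 ≤ μ s (boldA γ s) := fun s => (hμ s _ (hpos s)).1
  refine ⟨fun b s => ⟨(hγ b s).le, hΓ s, ?_, ?_⟩, fun b c' a' hf => ?_⟩
  · rw [Finset.sum_add_distrib]
    simp only [Finset.sum_const, Finset.card_univ, Fintype.card_fin, nsmul_eq_mul]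
    rw [mul_div_cancel₀ _ hM0.ne']
    linarith
  · have := div_nonneg (hμ0 s) hM0.le
    linarith
  · rw [Lagg, Lagg, ← Finset.sum_add_distrib, ← Finset.sum_add_distrib]
    refine Finset.sum_le_sum fun s _ => ?_
    obtain ⟨-, h2, h3, -⟩ := hf s
    set A' := Function.update γ b a' with hA'
    have h2' : alow (σ s) ≤ boldA A' s := h2
    have hopt := maximizer_cost_le (hμ s) ((hσ s).alow_pos.trans_le h2') (hpos s)
    have hc : ∀ C : Fin M → Fin N → ℝ,
        ∑ j, Function.update C b c' j s = c' s + ∑ j ∈ Finset.univ.erase b, C j s :=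
      fun C => boldA_update C b c' s
    have hb : A' b s = a' s := by rw [hA', Function.update_self]
    have hq : ∑ j, qb σ μ ξ A' j s =
        (a' s + ∑ j ∈ Finset.univ.erase b, γ j s) * Vval σ μ A' s := by
      rw [← boldA_update γ b a' s, boldA, Finset.sum_mul]
      simp only [qb, hrow, hA']
    have hcard : ∑ j ∈ Finset.univ.erase b, μ s (boldA γ s) / (M : ℝ) =
        μ s (boldA γ s) - μ s (boldA γ s) / M := by
      have := Finset.add_sum_erase Finset.univ
        (fun _ : Fin M => μ s (boldA γ s) / (M : ℝ)) (Finset.mem_univ b)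
      simp only [Finset.sum_const, Finset.card_univ, Fintype.card_fin, nsmul_eq_mul,
        mul_div_cancel₀ _ hM0.ne'] at this ⊢
      linarith
    rw [hc, hq, Finset.sum_add_distrib, hcard] at h3
    simp only [qb, hrow, ← Finset.sum_mul] at h3 ⊢
    rw [Function.update_self, hb]
    rw [boldA_eq_add_erase γ b s] at hopt
    simp only [Vval] at h3 ⊢
    rw [boldA_eq_add_erase γ b s] at h3 ⊢
    linarith

/-- The social cost is minimized by the efforts under the total demands. -/
theorem SC_maximizer_le {Γ : Fin N → ℝ} (hΓ : ∀ s, 0 < Γ s)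
    (hμ : ∀ s, ∀ a : ℝ, 0 < a →
      UniqueMaxOn (fun e => -a * σ s e ^ 2 - e) (Set.Ici 0) (μ s a))
    {e : Fin N → ℝ} (he : ∀ s, 0 ≤ e s) :
    SC Γ σ (fun s => μ s (Γ s)) ≤ SC Γ σ e := by
  rw [SC, SC, ← Finset.sum_add_distrib, ← Finset.sum_add_distrib]
  refine Finset.sum_le_sum fun s _ => ?_
  have := (hμ s _ (hΓ s)).2.1 (e s) (he s)
  simp only at this
  linarith

/-- The social cost has a unique minimizer. -/
theorem eq_maximizer_of_SC_le {Γ : Fin N → ℝ} (hΓ : ∀ s, 0 < Γ s)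
    (hμ : ∀ s, ∀ a : ℝ, 0 < a →
      UniqueMaxOn (fun e => -a * σ s e ^ 2 - e) (Set.Ici 0) (μ s a))
    {e : Fin N → ℝ} (he : ∀ s, 0 ≤ e s) (hle : SC Γ σ e ≤ SC Γ σ (fun s => μ s (Γ s)))
    (s : Fin N) : e s = μ s (Γ s) := by
  have heq := hle.antisymm' (SC_maximizer_le hΓ hμ he)
  rw [SC, SC, ← Finset.sum_add_distrib, ← Finset.sum_add_distrib] at heq
  have hterm := (Finset.sum_eq_sum_iff_of_le fun i _ => by
    have := (hμ i _ (hΓ i)).2.1 (e i) (he i)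
    simp only at this
    linarith).1 heq s (Finset.mem_univ s)
  refine (hμ s _ (hΓ s)).2.2 (e s) (he s) fun y hy => ?_
  have := (hμ s _ (hΓ s)).2.1 y hy
  simp only at this ⊢
  linarith

end Game

theorem stmt_14 (N M : ℕ) (hN : 1 ≤ N) (hM : 2 ≤ M)
    (σ μ : Fin N → ℝ → ℝ) (ξ : Fin M → Fin N → Fin N → ℝ) (γ : Fin M → Fin N → ℝ)
    (hσ : ∀ s, SigmaOK (σ s))
    (hμ : ∀ s, ∀ a : ℝ, 0 < a →
      UniqueMaxOn (fun e => -a * σ s e ^ 2 - e) (Set.Ici 0) (μ s a))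
    (hξ0 : ∀ b i l, 0 ≤ ξ b i l) (hξ1 : ∀ b i, ξ b i i = 1)
    (hγ : ∀ b i, 0 < γ b i)
    (hΓ : ∀ s, alow (σ s) ≤ ∑ j, γ j s) :
    (∃ c a : Fin M → Fin N → ℝ,
      IsGNE σ μ ξ γ (fun s => Set.Ici (alow (σ s))) c a ∧
      (∀ s, 0 ≤ μ s (boldA a s)) ∧
      ∀ e : Fin N → ℝ, (∀ s, 0 ≤ e s) →
        SC (fun s => ∑ j, γ j s) σ (fun s => μ s (boldA a s)) ≤
          SC (fun s => ∑ j, γ j s) σ e) ↔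
    (∀ j i l, i ≠ l → ξ j i l = 0) := by
  have hpos : ∀ s, 0 < ∑ j, γ j s := fun s => (hσ s).alow_pos.trans_le (hΓ s)
  constructor
  · rintro ⟨c, a, hG, h0, hopt⟩ j i l hil
    refine hG.coupling_eq_zero hM hσ hμ hξ0 hξ1 hγ (fun s => ?_) hil
    have hs := eq_maximizer_of_SC_le hpos hμ h0
      (hopt _ fun s => (hμ s _ (hpos s)).1) s
    have hA : alow (σ s) ≤ boldA a s := (hG.1 j s).2.1
    rw [← (hσ s).effortWeight_maximizer (hμ s) hA, hs,
      (hσ s).effortWeight_maximizer (hμ s) (hΓ s)]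
  · intro hξ
    exact ⟨_, γ, isGNE_of_uncoupled hM hσ hμ hξ1 hγ hΓ hξ,
      fun s => (hμ s _ (hpos s)).1, fun e he => SC_maximizer_le hpos hμ he⟩
end

section
/- In the partial-sharing data-market game with unbounded effort (ℰ_s = [0,∞) and 𝒜_s = [𝒂̲_s, ∞) for every s), suppose 𝛄_s ≥ 𝒂̲_s for every s and γ_s^b > 0 whenever s ∈ 𝒮_b, and suppose a generalized Nash equilibrium (c̄,ā) exists. Then: (1) if |ℬ_s| = 1 for every s, then (c̄,ā) is the unique generalized Nash equilibrium; (2) if |ℬ_s| ≥ 2 for some s, then there are infinitely many generalized Nash equilibria. -/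
variable {N M : ℕ}

/-- `𝒮_b = { s : b ∈ ℬ_s }`, the sources selling to aggregator `b`. -/
def Sagg (B : Fin N → Finset (Fin M)) (b : Fin M) : Finset (Fin N) :=
  Finset.univ.filter fun s => b ∈ B s

/-- `𝒂_s = Σ_{j ∈ ℬ_s} a_s^j`. -/
noncomputable def boldAP (B : Fin N → Finset (Fin M)) (a : Fin M → Fin N → ℝ)
    (s : Fin N) : ℝ :=
  ∑ j ∈ B s, a j s

/-- `σ_i(μ_i(𝒂_i))²`, the equilibrium variance of source `i`'s data. -/
noncomputable def VvalP (σ μ : Fin N → ℝ → ℝ) (B : Fin N → Finset (Fin M))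
    (a : Fin M → Fin N → ℝ) (i : Fin N) : ℝ :=
  σ i (μ i (boldAP B a i)) ^ 2

/-- `q_s^b(a) = a_s^b Σ_{i ∈ 𝒮_b} ξ_{s,i}^b σ_i(μ_i(𝒂_i))²`. -/
noncomputable def qbP (σ μ : Fin N → ℝ → ℝ) (ξ : Fin M → Fin N → Fin N → ℝ)
    (B : Fin N → Finset (Fin M)) (a : Fin M → Fin N → ℝ) (b : Fin M) (s : Fin N) : ℝ :=
  a b s * ∑ i ∈ Sagg B b, ξ b s i * VvalP σ μ B a i

/-- `q_s(a) = Σ_{j ∈ ℬ_s} q_s^j(a) + μ_s(𝒂_s)`. -/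
noncomputable def qtotP (σ μ : Fin N → ℝ → ℝ) (ξ : Fin M → Fin N → Fin N → ℝ)
    (B : Fin N → Finset (Fin M)) (a : Fin M → Fin N → ℝ) (s : Fin N) : ℝ :=
  (∑ j ∈ B s, qbP σ μ ξ B a j s) + μ s (boldAP B a s)

/-- Aggregator `b`'s loss `L^b` in the partial-sharing game. -/
noncomputable def LaggP (σ μ : Fin N → ℝ → ℝ) (ξ : Fin M → Fin N → Fin N → ℝ)
    (γ : Fin M → Fin N → ℝ) (B : Fin N → Finset (Fin M))
    (c a : Fin M → Fin N → ℝ) (b : Fin M) : ℝ :=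
  (∑ i, γ b i * VvalP σ μ B a i) +
    ∑ i ∈ Sagg B b, (c b i - a b i * ∑ l ∈ Sagg B b, ξ b i l * VvalP σ μ B a l)

/-- Feasibility of `(c^b, a^b)` for aggregator `b` within the profile `(c,a)`.
Coordinates corresponding to sources outside `𝒮_b` are required to be zero
(aggregator `b` issues no contract to them). -/
def FeasibleP (σ μ : Fin N → ℝ → ℝ) (ξ : Fin M → Fin N → Fin N → ℝ)
    (B : Fin N → Finset (Fin M)) (𝒜 : Fin N → Set ℝ)
    (c a : Fin M → Fin N → ℝ) (b : Fin M) : Prop :=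
  (∀ s, b ∈ B s → 0 ≤ a b s ∧ boldAP B a s ∈ 𝒜 s ∧
    μ s (boldAP B a s) ≤ ∑ j ∈ B s, (c j s - qbP σ μ ξ B a j s) ∧
    0 ≤ c b s - qbP σ μ ξ B a b s) ∧
  ∀ s, b ∉ B s → a b s = 0 ∧ c b s = 0

/-- Generalized Nash equilibrium of the partial-sharing game between the aggregators. -/
def IsGNEP (σ μ : Fin N → ℝ → ℝ) (ξ : Fin M → Fin N → Fin N → ℝ)
    (γ : Fin M → Fin N → ℝ) (B : Fin N → Finset (Fin M)) (𝒜 : Fin N → Set ℝ)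
    (c a : Fin M → Fin N → ℝ) : Prop :=
  (∀ b, FeasibleP σ μ ξ B 𝒜 c a b) ∧
    ∀ b (c' a' : Fin N → ℝ),
      FeasibleP σ μ ξ B 𝒜 (Function.update c b c') (Function.update a b a') b →
      LaggP σ μ ξ γ B c a b ≤
        LaggP σ μ ξ γ B (Function.update c b c') (Function.update a b a') b

/-- The price coefficient at which the effort `e` is optimal. -/
noncomputable def priceOf (σ : ℝ → ℝ) (e : ℝ) : ℝ := -1 / (2 * σ e * sigd σ e)

namespace SigmaOK

variable {σ : ℝ → ℝ}

lemma differentiableOn (h : SigmaOK σ) : DifferentiableOn ℝ σ (Set.Ici 0) :=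
  h.2.2.2.differentiableOn (by norm_num)

lemma tangent_le_s17 (h : SigmaOK σ) {e x : ℝ} (he : 0 ≤ e) (hx : 0 ≤ x) :
    σ e + sigd σ e * (x - e) ≤ σ x := by
  have hd := (h.differentiableOn e he).hasDerivWithinAt
  rcases lt_trichotomy e x with hlt | rfl | hlt
  · have := h.2.2.1.le_slope_of_hasDerivWithinAt he hx hlt hd
    rw [slope_def_field, le_div_iff₀ (by linarith)] at this
    unfold sigd; linarith
  · simp
  · have := h.2.2.1.slope_le_of_hasDerivWithinAt hx he hlt hd
    rw [slope_def_field, div_le_iff₀ (by linarith)] at this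
    unfold sigd; linarith

lemma sigd_neg_s17 (h : SigmaOK σ) {e : ℝ} (he : 0 ≤ e) : sigd σ e < 0 := by
  have h1 := h.tangent_le_s17 he (x := e + 1) (by linarith)
  have h2 := h.2.1 (Set.mem_Ici.2 he) (Set.mem_Ici.2 (by linarith : (0:ℝ) ≤ e + 1))
    (by linarith)
  linarith

lemma priceOf_pos (h : SigmaOK σ) {e : ℝ} (he : 0 ≤ e) : 0 < priceOf σ e := by
  have h1 := h.1 e he
  have h2 := h.sigd_neg_s17 he
  exact div_pos_of_neg_of_neg (by norm_num) (by nlinarith)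

lemma alow_pos_s17 (h : SigmaOK σ) : 0 < alow σ := h.priceOf_pos le_rfl

lemma sq_lt_sq_s17 (h : SigmaOK σ) {e x : ℝ} (he : 0 ≤ e) (hx : e < x) : σ x ^ 2 < σ e ^ 2 := by
  have := h.2.1 (Set.mem_Ici.2 he) (Set.mem_Ici.2 (by linarith : (0:ℝ) ≤ x)) hx
  exact pow_lt_pow_left₀ this (h.1 x (by simp; linarith)).le (by norm_num)

lemma priceOf_min (h : SigmaOK σ) {e x : ℝ} (he : 0 ≤ e) (hx : 0 ≤ x) :
    priceOf σ e * σ e ^ 2 + e ≤ priceOf σ e * σ x ^ 2 + x := by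
  have h1 := h.1 e he
  have h2 := h.sigd_neg_s17 he
  have h3 := h.tangent_le_s17 he hx
  have hp := h.priceOf_pos he
  have h4 : priceOf σ e * (2 * σ e * sigd σ e) = -1 :=
    div_mul_cancel₀ _ (by nlinarith)
  have h5 : 2 * σ e * sigd σ e * (x - e) ≤ σ x ^ 2 - σ e ^ 2 := by
    nlinarith [sq_nonneg (σ x - σ e)]
  nlinarith [mul_le_mul_of_nonneg_left h5 hp.le]

lemma priceOf_continuousOn (h : SigmaOK σ) : ContinuousOn (priceOf σ) (Set.Ici 0) := by
  have hc : ContinuousOn (sigd σ) (Set.Ici 0) :=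
    h.2.2.2.continuousOn_derivWithin (uniqueDiffOn_Ici 0) (by norm_num)
  refine continuousOn_const.div ((continuousOn_const.mul h.2.2.2.continuousOn).mul hc) ?_
  intro e he
  have h1 := h.1 e he
  have h2 := h.sigd_neg_s17 he
  nlinarith

lemma priceOf_mono (h : SigmaOK σ) {e x : ℝ} (he : 0 ≤ e) (hx : e ≤ x) :
    priceOf σ e ≤ priceOf σ x := by
  rcases hx.eq_or_lt with rfl | hlt
  · rfl
  have h1 := h.priceOf_min he (he.trans hx)
  have h2 := h.priceOf_min (he.trans hx) he
  have h3 := h.sq_lt_sq_s17 he hlt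
  nlinarith

lemma eq_of_uniqueMax (h : SigmaOK σ) {a m : ℝ} {e : ℝ} (he : 0 ≤ e) (ha : a = priceOf σ e)
    (hm : UniqueMaxOn (fun e => -a * σ e ^ 2 - e) (Set.Ici 0) m) : m = e := by
  refine (hm.2.2 e he fun x hx => ?_).symm
  have := h.priceOf_min he hx
  subst ha
  simp only
  linarith

lemma priceOf_of_uniqueMax (h : SigmaOK σ) {a m : ℝ} (ha : alow σ ≤ a)
    (hm : UniqueMaxOn (fun e => -a * σ e ^ 2 - e) (Set.Ici 0) m) : priceOf σ m = a := by
  have hm0 : 0 ≤ m := hm.1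
  have hmax : ∀ x, 0 ≤ x → a * σ m ^ 2 + m ≤ a * σ x ^ 2 + x := fun x hx => by
    have := hm.2.1 x hx
    simp only at this
    linarith
  have hcont := h.priceOf_continuousOn m hm0
  rcases lt_trichotomy (priceOf σ m) a with hlt | heq | hgt
  · exfalso
    have hev : ∀ᶠ x in nhdsWithin m (Set.Ioi m), priceOf σ x < a :=
      (hcont.mono (fun x hx => hm0.trans (le_of_lt hx))).eventually (eventually_lt_nhds hlt)
    obtain ⟨x, hx, hmx⟩ := (hev.and self_mem_nhdsWithin).exists
    have hmx : m < x := hmx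
    have h1 := h.priceOf_min (hm0.trans hmx.le) hm0
    have h2 := hmax x (hm0.trans hmx.le)
    have h3 := h.sq_lt_sq_s17 hm0 hmx
    nlinarith
  · exact heq
  · exfalso
    have hm1 : 0 < m := by
      rcases hm0.eq_or_lt with h0 | h0
      · subst h0
        exact absurd hgt (not_lt.2 ha)
      · exact h0
    have hev : ∀ᶠ x in nhdsWithin m (Set.Ico 0 m), a < priceOf σ x :=
      (hcont.mono (fun x hx => hx.1)).eventually (eventually_gt_nhds hgt)
    rw [nhdsWithin_Ico_eq_nhdsLT hm1] at hev
    obtain ⟨x, ⟨hx, hx0⟩, hmx⟩ :=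
      ((hev.and (mem_nhdsWithin_of_mem_nhds (lt_mem_nhds hm1))).and self_mem_nhdsWithin).exists
    have hmx : x < m := hmx
    have hx0 : 0 < x := hx0
    have h1 := h.priceOf_min hx0.le hm0
    have h2 := hmax x hx0.le
    have h3 := h.sq_lt_sq_s17 hx0.le hmx
    nlinarith

end SigmaOK

/-- Theorem of the alternative for an affine map on a box. -/
lemma exists_nonneg_of_forall_dual {n : ℕ} (lo c : Fin n → ℝ) (K : Fin n → Fin n → ℝ)
    (h : ∀ d : Fin n → ℝ, 0 ≤ d → ∃ x ∈ Set.Icc lo 1, 0 ≤ ∑ l, d l * (c l + ∑ i, x i * K i l)) :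
    ∃ x ∈ Set.Icc lo 1, ∀ l, 0 ≤ c l + ∑ i, x i * K i l := by
  by_contra! hcon
  set g : (Fin n → ℝ) → Fin n → ℝ := fun x l => c l + ∑ i, x i * K i l with hg
  have hgc : Continuous g := by fun_prop
  have hconv : Convex ℝ (g '' Set.Icc lo 1) := by
    rintro _ ⟨x, hx, rfl⟩ _ ⟨y, hy, rfl⟩ p q hp hq hpq
    refine ⟨p • x + q • y, convex_Icc lo 1 hx hy hp hq hpq, ?_⟩
    ext l
    have : ∑ i, (p * x i + q * y i) * K i l =
        p * ∑ i, x i * K i l + q * ∑ i, y i * K i l := by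
      rw [Finset.mul_sum, Finset.mul_sum, ← Finset.sum_add_distrib]
      exact Finset.sum_congr rfl fun i _ => by ring
    simp only [hg, Pi.add_apply, Pi.smul_apply, smul_eq_mul, this]
    linear_combination (-(c l)) * hpq
  have hdisj : Disjoint (g '' Set.Icc lo 1) (Set.Ici 0) := by
    rw [Set.disjoint_left]
    rintro _ ⟨x, hx, rfl⟩ hpos
    obtain ⟨l, hl⟩ := hcon x hx
    exact absurd (hpos l) (not_le.2 hl)
  obtain ⟨f, u, v, hfu, huv, hfv⟩ := geometric_hahn_banach_compact_closed hconv
    (isCompact_Icc.image hgc) (convex_Ici 0) isClosed_Ici hdisj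
  have hv0 : v < 0 := by simpa using hfv 0 (Set.mem_Ici.2 le_rfl)
  have hfnn : ∀ w : Fin n → ℝ, 0 ≤ w → 0 ≤ f w := by
    intro w hw
    by_contra! hneg
    have := hfv ((v / f w) • w) (smul_nonneg (div_nonneg_of_nonpos hv0.le hneg.le) hw)
    rw [map_smul, smul_eq_mul, div_mul_cancel₀ _ hneg.ne] at this
    exact lt_irrefl _ this
  have hfs : ∀ w : Fin n → ℝ, f w = ∑ l, f (Pi.single l 1) * w l := by
    intro w
    conv_lhs => rw [pi_eq_sum_univ' w]
    simp [map_sum, mul_comm]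
  obtain ⟨x, hx, hx0⟩ := h (fun l => f (Pi.single l 1))
    (fun l => hfnn _ (by simp))
  have := hfu (g x) ⟨x, hx, rfl⟩
  rw [hfs] at this
  linarith

open Filter Topology in
/-- One-sided first-order condition for a sum of positive parts, in the limit `t → 0⁺`. -/
lemma nonneg_of_forall_dev {ι : Type*} (S : Finset ι) (p F g A d : ι → ℝ) (W : ι → ι → ℝ)
    (r : ι → ℝ → ℝ) (hr : ∀ l ∈ S, Tendsto (r l) (𝓝[>] 0) (𝓝 1))
    (hF : ∀ i ∈ S, p i = max 0 (F i))
    (hdev : ∀ t > 0, ∑ i ∈ S, p i ≤ -(t * ∑ l ∈ S, g l * d l * r l t) +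
      ∑ i ∈ S, max 0 (F i + t * (A i * d i - ∑ l ∈ S, W i l * d l * r l t))) :
    0 ≤ -(∑ l ∈ S, g l * d l) + ∑ i ∈ S,
      (if 0 < p i then A i * d i - ∑ l ∈ S, W i l * d l
        else max 0 (A i * d i - ∑ l ∈ S, W i l * d l)) := by
  set H : ι → ℝ → ℝ := fun i t => A i * d i - ∑ l ∈ S, W i l * d l * r l t with hH
  have hHt : ∀ i, Tendsto (H i) (𝓝[>] 0) (𝓝 (A i * d i - ∑ l ∈ S, W i l * d l)) := by
    intro i
    refine tendsto_const_nhds.sub (tendsto_finsetSum _ fun l hl => ?_)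
    simpa using (hr l hl).const_mul (W i l * d l)
  have hlim : Tendsto (fun t => -(∑ l ∈ S, g l * d l * r l t) + ∑ i ∈ S,
      (if 0 < p i then H i t else max 0 (H i t))) (𝓝[>] 0)
      (𝓝 (-(∑ l ∈ S, g l * d l) + ∑ i ∈ S,
      (if 0 < p i then A i * d i - ∑ l ∈ S, W i l * d l
        else max 0 (A i * d i - ∑ l ∈ S, W i l * d l)))) := by
    refine Tendsto.add (Tendsto.neg (tendsto_finsetSum _ fun l hl => ?_))
      (tendsto_finsetSum _ fun i _ => ?_)
    · simpa using (hr l hl).const_mul (g l * d l)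
    · split_ifs
      · exact hHt i
      · exact tendsto_const_nhds.max (hHt i)
  have hev : ∀ᶠ t in 𝓝[>] (0:ℝ), ∀ i ∈ S, 0 < p i → 0 < p i + t * H i t := by
    rw [Finset.eventually_all]
    intro i _
    by_cases hp : 0 < p i
    · have ht : Tendsto (fun t : ℝ => p i + t * H i t) (𝓝[>] 0) (𝓝 (p i + 0 *
          (A i * d i - ∑ l ∈ S, W i l * d l))) :=
        tendsto_const_nhds.add ((tendsto_nhdsWithin_of_tendsto_nhds tendsto_id).mul (hHt i))
      rw [zero_mul, add_zero] at ht
      exact (ht.eventually (lt_mem_nhds hp)).mono fun t h _ => h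
    · exact Eventually.of_forall fun t h => absurd h hp
  refine ge_of_tendsto hlim ?_
  filter_upwards [hev, self_mem_nhdsWithin] with t ht ht0
  have ht0 : 0 < t := ht0
  have h1 := hdev t ht0
  have h2 : ∑ i ∈ S, max 0 (F i + t * H i t) ≤ ∑ i ∈ S, p i + t * ∑ i ∈ S,
      (if 0 < p i then H i t else max 0 (H i t)) := by
    rw [Finset.mul_sum, ← Finset.sum_add_distrib]
    refine Finset.sum_le_sum fun i hi => ?_
    have hFi := hF i hi
    split_ifs with hp
    · have hFp : F i = p i := by
        rcases max_cases 0 (F i) with h | h <;> linarith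
      rw [hFp, max_eq_right (ht i hi hp).le]
    · have h0 : F i ≤ p i := hFi ▸ le_max_right _ _
      have h0' : 0 ≤ p i := hFi ▸ le_max_left _ _
      have h3 := mul_le_mul_of_nonneg_left (le_max_left 0 (H i t)) ht0.le
      have h4 := mul_le_mul_of_nonneg_left (le_max_right 0 (H i t)) ht0.le
      exact max_le (by linarith) (by linarith)
  have h3 : 0 ≤ t * (-(∑ l ∈ S, g l * d l * r l t) + ∑ i ∈ S,
      (if 0 < p i then H i t else max 0 (H i t))) := by
    simp only [hH] at h1 h2 ⊢
    linarith
  exact nonneg_of_mul_nonneg_right h3 ht0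

section Game

variable {σ μ : Fin N → ℝ → ℝ} {ξ : Fin M → Fin N → Fin N → ℝ} {γ : Fin M → Fin N → ℝ}
  {B : Fin N → Finset (Fin M)} {𝒜 : Fin N → Set ℝ} {c a : Fin M → Fin N → ℝ}

/-- The sensitivity of the payments of the competitors of `b` to source `i` with respect to the
variance of source `l`. -/
noncomputable def crossWeight (ξ : Fin M → Fin N → Fin N → ℝ) (B : Fin N → Finset (Fin M))
    (a : Fin M → Fin N → ℝ) (b : Fin M) (i l : Fin N) : ℝ :=
  ∑ j ∈ (B i).erase b, a j i * if j ∈ B l then ξ j i l else 0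

lemma mem_Sagg {b : Fin M} {s : Fin N} : s ∈ Sagg B b ↔ b ∈ B s := by simp [Sagg]

lemma boldAP_eq {b : Fin M} {s : Fin N} (hb : b ∈ B s) :
    boldAP B a s = a b s + ∑ j ∈ (B s).erase b, a j s :=
  (Finset.add_sum_erase _ _ hb).symm

lemma boldAP_update {b : Fin M} {s : Fin N} (hb : b ∈ B s) (x : Fin N → ℝ) :
    boldAP B (Function.update a b x) s = x s + ∑ j ∈ (B s).erase b, a j s := by
  rw [boldAP_eq hb, Function.update_self]
  congr 1
  refine Finset.sum_congr rfl fun j hj => ?_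
  rw [Function.update_of_ne (Finset.ne_of_mem_erase hj)]

lemma boldAP_update_of_notMem {b : Fin M} {s : Fin N} (hb : b ∉ B s) (x : Fin N → ℝ) :
    boldAP B (Function.update a b x) s = boldAP B a s := by
  refine Finset.sum_congr rfl fun j hj => ?_
  rw [Function.update_of_ne]
  rintro rfl
  exact hb hj

lemma VvalP_update_of_notMem {b : Fin M} {s : Fin N} (hb : b ∉ B s) (x : Fin N → ℝ) :
    VvalP σ μ B (Function.update a b x) s = VvalP σ μ B a s := by
  rw [VvalP, VvalP, boldAP_update_of_notMem hb]

lemma sum_erase_qbP {a' : Fin M → Fin N → ℝ} {b : Fin M} (i : Fin N)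
    (h : ∀ j, j ≠ b → a' j = a j) :
    ∑ j ∈ (B i).erase b, qbP σ μ ξ B a' j i =
      ∑ l, crossWeight ξ B a b i l * VvalP σ μ B a' l := by
  simp only [crossWeight, Finset.sum_mul]
  rw [Finset.sum_comm]
  refine Finset.sum_congr rfl fun j hj => ?_
  rw [qbP, h j (Finset.ne_of_mem_erase hj), Sagg, Finset.sum_filter, Finset.mul_sum]
  refine Finset.sum_congr rfl fun l _ => ?_
  split_ifs <;> ring

lemma crossWeight_self (hξ1 : ∀ b i, b ∈ B i → ξ b i i = 1) (b : Fin M) (i : Fin N) :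
    crossWeight ξ B a b i i = ∑ j ∈ (B i).erase b, a j i := by
  refine Finset.sum_congr rfl fun j hj => ?_
  have := Finset.mem_of_mem_erase hj
  rw [if_pos this, hξ1 j i this, mul_one]

lemma crossWeight_mono (hξ0 : ∀ b i l, b ∈ B i → b ∈ B l → 0 ≤ ξ b i l)
    {a' : Fin M → Fin N → ℝ} (h : a ≤ a') (b : Fin M) (i l : Fin N) :
    crossWeight ξ B a b i l ≤ crossWeight ξ B a' b i l := by
  refine Finset.sum_le_sum fun j hj => mul_le_mul_of_nonneg_right (h j i) ?_
  split_ifs with hl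
  · exact hξ0 j i l (Finset.mem_of_mem_erase hj) hl
  · rfl

lemma crossWeight_nonneg (hξ0 : ∀ b i l, b ∈ B i → b ∈ B l → 0 ≤ ξ b i l)
    (h : ∀ b i, b ∈ B i → 0 ≤ a b i) (b : Fin M) (i l : Fin N) :
    0 ≤ crossWeight ξ B a b i l := by
  refine Finset.sum_nonneg fun j hj => ?_
  have hj' := Finset.mem_of_mem_erase hj
  refine mul_nonneg (h j i hj') ?_
  split_ifs with hl
  · exact hξ0 j i l hj' hl
  · rfl

/-- In an equilibrium, `b` cannot gain by changing `a^b` and paying the least amounts that keep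
all its sources participating. -/
lemma IsGNEP.le_of_deviation (hG : IsGNEP σ μ ξ γ B 𝒜 c a) (b : Fin M) (x : Fin N → ℝ)
    (hx : ∀ s, b ∈ B s → 0 ≤ x s ∧ boldAP B (Function.update a b x) s ∈ 𝒜 s)
    (hoff : ∀ s, b ∉ B s → x s = 0) :
    LaggP σ μ ξ γ B c a b ≤ ∑ i, γ b i * VvalP σ μ B (Function.update a b x) i +
      ∑ i ∈ Sagg B b, max 0 (μ i (boldAP B (Function.update a b x) i) -
        ∑ j ∈ (B i).erase b, c j i +
        ∑ l, crossWeight ξ B a b i l * VvalP σ μ B (Function.update a b x) l) := by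
  set a' := Function.update a b x with ha'
  set R : Fin N → ℝ := fun i => max 0 (μ i (boldAP B a' i) -
        ∑ j ∈ (B i).erase b, c j i + ∑ l, crossWeight ξ B a b i l * VvalP σ μ B a' l) with hR
  have h := hG.2 b (fun i => if b ∈ B i then qbP σ μ ξ B a' b i + R i else 0) x ?_
  · refine h.trans_eq ?_
    rw [LaggP]
    congr 1
    refine Finset.sum_congr rfl fun i hi => ?_
    rw [Function.update_self, if_pos (mem_Sagg.1 hi)]
    exact add_sub_cancel_left _ _
  · refine ⟨fun s hs => ⟨?_, (hx s hs).2, ?_, ?_⟩, fun s hs => ?_⟩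
    · rw [Function.update_self]; exact (hx s hs).1
    · rw [← Finset.add_sum_erase _ _ hs, Function.update_self, if_pos hs, ← ha',
        add_sub_cancel_left, Finset.sum_sub_distrib,
        sum_erase_qbP s (fun j hj => Function.update_of_ne hj x a)]
      have h1 : ∑ j ∈ (B s).erase b, Function.update c b
          (fun i => if b ∈ B i then qbP σ μ ξ B a' b i + R i else 0) j s =
          ∑ j ∈ (B s).erase b, c j s := Finset.sum_congr rfl fun j hj => by
        rw [Function.update_of_ne (Finset.ne_of_mem_erase hj)]
      rw [h1]
      have h2 : _ ≤ R s := le_max_right _ _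
      linarith
    · rw [Function.update_self, if_pos hs, ← ha', add_sub_cancel_left]
      exact le_max_left _ _
    · rw [Function.update_self, Function.update_self, if_neg hs]
      exact ⟨hoff s hs, rfl⟩


/-- Upper bound on a nonnegative combination of variances that change only on `S`. -/
lemma sum_mul_le_of_le_on {ι : Type*} [Fintype ι] (S : Finset ι) (k V V' D : ι → ℝ)
    (hk : ∀ l ∈ S, 0 ≤ k l) (hoff : ∀ l, l ∉ S → V' l = V l) (hD : ∀ l ∈ S, V' l ≤ V l - D l) :
    ∑ l, k l * V' l ≤ ∑ l, k l * V l - ∑ l ∈ S, k l * D l := by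
  have h : ∑ l ∈ S, k l * D l ≤ ∑ l, k l * (V l - V' l) := by
    rw [← Finset.sum_subset (Finset.subset_univ S)
      (fun l _ hl => by rw [hoff l hl, sub_self, mul_zero])]
    exact Finset.sum_le_sum fun l hl =>
      mul_le_mul_of_nonneg_left (by linarith [hD l hl]) (hk l hl)
  simp only [mul_sub, Finset.sum_sub_distrib] at h
  linarith

open Filter Topology in
/-- Karush–Kuhn–Tucker multipliers of aggregator `b`'s problem at an equilibrium. -/
lemma IsGNEP.exists_multiplier (hσ : ∀ s, SigmaOK (σ s))
    (hμ : ∀ s, ∀ a : ℝ, 0 < a →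
      UniqueMaxOn (fun e => -a * σ s e ^ 2 - e) (Set.Ici 0) (μ s a))
    (hξ0 : ∀ b i l, b ∈ B i → b ∈ B l → 0 ≤ ξ b i l)
    (hγ : ∀ b s, b ∈ B s → 0 < γ b s)
    (hG : IsGNEP σ μ ξ γ B (fun s => Set.Ici (alow (σ s))) c a) (b : Fin M) :
    ∃ lam : Fin N → ℝ, (∀ i, 0 ≤ lam i ∧ lam i ≤ 1) ∧
      (∀ i, b ∈ B i → 0 < c b i - qbP σ μ ξ B a b i → lam i = 1) ∧
      ∀ l, b ∈ B l → γ b l + ∑ i ∈ Sagg B b, lam i * crossWeight ξ B a b i l ≤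
        lam l * boldAP B a l := by
  set S := Sagg B b with hS
  set A : Fin N → ℝ := fun l => boldAP B a l with hA
  set e : Fin N → ℝ := fun l => μ l (A l) with he
  set V : Fin N → ℝ := fun l => VvalP σ μ B a l with hV
  set W : Fin N → Fin N → ℝ := fun i l => crossWeight ξ B a b i l with hW
  set p : Fin N → ℝ := fun i => c b i - qbP σ μ ξ B a b i with hp
  set F : Fin N → ℝ := fun i => e i - ∑ j ∈ (B i).erase b, c j i + ∑ l, W i l * V l with hFdef
  have hW0 : ∀ i l, 0 ≤ W i l := fun i l =>
    crossWeight_nonneg hξ0 (fun b i hb => ((hG.1 b).1 i hb).1) b i l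
  have hAlow : ∀ l ∈ S, alow (σ l) ≤ A l := fun l hl => ((hG.1 b).1 l (mem_Sagg.1 hl)).2.1
  have hApos : ∀ l ∈ S, 0 < A l := fun l hl => (hσ l).alow_pos_s17.trans_le (hAlow l hl)
  have he0 : ∀ l ∈ S, 0 ≤ e l := fun l hl => (hμ l _ (hApos l hl)).1
  have hprice : ∀ l ∈ S, priceOf (σ l) (e l) = A l := fun l hl =>
    (hσ l).priceOf_of_uniqueMax (hAlow l hl) (hμ l _ (hApos l hl))
  have hFp : ∀ i ∈ S, max 0 (F i) ≤ p i := by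
    intro i hi
    have hb := mem_Sagg.1 hi
    obtain ⟨-, -, h3, h4⟩ := (hG.1 b).1 i hb
    refine max_le h4 ?_
    rw [← Finset.add_sum_erase _ _ hb, Finset.sum_sub_distrib,
      sum_erase_qbP i (fun _ _ => rfl)] at h3
    simp only [hFdef, hp, he, hA, hV, hW]
    linarith
  have hL : LaggP σ μ ξ γ B c a b = ∑ l, γ b l * V l + ∑ i ∈ S, p i := rfl
  have hF : ∀ i ∈ S, p i = max 0 (F i) := by
    have h := hG.le_of_deviation b (a b)
      (fun s hs => by
        rw [Function.update_eq_self]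
        exact ⟨((hG.1 b).1 s hs).1, ((hG.1 b).1 s hs).2.1⟩)
      (fun s hs => ((hG.1 b).2 s hs).1)
    rw [Function.update_eq_self, hL] at h
    have h' : ∑ i ∈ S, p i ≤ ∑ i ∈ S, max 0 (F i) := by
      simp only [hFdef, he, hA, hV, hW] at h ⊢
      linarith
    intro i hi
    exact ((Finset.sum_eq_sum_iff_of_le hFp).1 (le_antisymm (Finset.sum_le_sum hFp) h') i hi).symm
  have hdual : ∀ d : Fin N → ℝ, 0 ≤ d → 0 ≤ -(∑ l ∈ S, γ b l * d l) + ∑ i ∈ S,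
      (if 0 < p i then A i * d i - ∑ l ∈ S, W i l * d l
        else max 0 (A i * d i - ∑ l ∈ S, W i l * d l)) := by
    intro d hd
    set P : Fin N → ℝ → ℝ := fun l t => priceOf (σ l) (e l + t * (A l * d l)) with hP
    refine nonneg_of_forall_dev S p F (γ b) A d W (fun l t => A l / P l t) ?_ hF ?_
    · intro l hl
      have h1 : Tendsto (fun t : ℝ => e l + t * (A l * d l)) (𝓝[>] 0)
          (𝓝[Set.Ici 0] (e l)) := by
        refine tendsto_nhdsWithin_iff.2 ⟨tendsto_nhdsWithin_of_tendsto_nhds ?_, ?_⟩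
        · have : Continuous fun t : ℝ => e l + t * (A l * d l) := by fun_prop
          simpa using this.tendsto 0
        · filter_upwards [self_mem_nhdsWithin] with t ht
          have ht : 0 < t := ht
          exact add_nonneg (he0 l hl) (mul_nonneg ht.le (mul_nonneg (hApos l hl).le (hd l)))
      have h2 := ((hσ l).priceOf_continuousOn (e l) (he0 l hl)).tendsto.comp h1
      rw [hprice l hl] at h2
      have h3 := (tendsto_const_nhds (x := A l)).div h2 (hApos l hl).ne'
      rwa [div_self (hApos l hl).ne'] at h3
    · intro t ht
      set x : Fin N → ℝ := fun l =>
        if b ∈ B l then P l t - ∑ j ∈ (B l).erase b, a j l else 0 with hx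
      have he' : ∀ l ∈ S, e l ≤ e l + t * (A l * d l) := fun l hl =>
        le_add_of_nonneg_right (mul_nonneg ht.le (mul_nonneg (hApos l hl).le (hd l)))
      have hbold : ∀ l ∈ S, boldAP B (Function.update a b x) l = P l t := by
        intro l hl
        have hb := mem_Sagg.1 hl
        rw [boldAP_update hb, hx]
        simp [hb]
      have hPA : ∀ l ∈ S, A l ≤ P l t := fun l hl => by
        rw [← hprice l hl]; exact (hσ l).priceOf_mono (he0 l hl) (he' l hl)
      have hPpos : ∀ l ∈ S, 0 < P l t := fun l hl => (hApos l hl).trans_le (hPA l hl)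
      have hmu : ∀ l ∈ S, μ l (P l t) = e l + t * (A l * d l) := fun l hl =>
        (hσ l).eq_of_uniqueMax ((he0 l hl).trans (he' l hl)) rfl (hμ l _ (hPpos l hl))
      have hdev := hG.le_of_deviation b x ?_ ?_
      rotate_left
      · intro s hs
        have hs' : s ∈ S := mem_Sagg.2 hs
        refine ⟨?_, ?_⟩
        · have h1 := hPA s hs'
          have h2 : A s = _ := boldAP_eq (a := a) hs
          have h3 := ((hG.1 b).1 s hs).1
          simp only [hx, if_pos hs]
          linarith
        · rw [hbold s hs']
          exact (hAlow s hs').trans (hPA s hs')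
      · intro s hs
        simp only [hx, if_neg hs]
      set V' : Fin N → ℝ := fun l => VvalP σ μ B (Function.update a b x) l with hV'
      have hVoff : ∀ l, l ∉ S → V' l = V l := fun l hl =>
        VvalP_update_of_notMem (fun h => hl (mem_Sagg.2 h)) x
      have hVon : ∀ l ∈ S, V' l ≤ V l - t * (d l * (A l / P l t)) := by
        intro l hl
        have h1 := (hσ l).priceOf_min ((he0 l hl).trans (he' l hl)) (he0 l hl)
        have h2 : V' l = σ l (e l + t * (A l * d l)) ^ 2 := by
          simp only [hV', VvalP, hbold l hl, hmu l hl]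
        have h3 : V l = σ l (e l) ^ 2 := rfl
        rw [← h2, ← h3] at h1
        have h4 : P l t * (V l - t * (d l * (A l / P l t)) - V' l) =
            P l t * V l - t * (A l * d l) - P l t * V' l := by
          have := (hPpos l hl).ne'
          field_simp
        have h5 : 0 ≤ P l t * (V l - t * (d l * (A l / P l t)) - V' l) := by
          rw [h4]
          simp only [hP]
          linarith
        linarith [nonneg_of_mul_nonneg_right h5 (hPpos l hl)]
      have hk : ∀ k : Fin N → ℝ, (∀ l ∈ S, 0 ≤ k l) → ∑ l, k l * V' l ≤
          ∑ l, k l * V l - t * ∑ l ∈ S, k l * d l * (A l / P l t) := by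
        intro k hk
        refine (sum_mul_le_of_le_on S k V V' _ hk hVoff hVon).trans_eq ?_
        rw [Finset.mul_sum]
        congr 1
        exact Finset.sum_congr rfl fun l _ => by ring
      have h1 := hk (γ b) fun l hl => (hγ b l (mem_Sagg.1 hl)).le
      have h2 : ∑ i ∈ S, max 0 (μ i (boldAP B (Function.update a b x) i) -
          ∑ j ∈ (B i).erase b, c j i + ∑ l, W i l * V' l) ≤
          ∑ i ∈ S, max 0 (F i + t * (A i * d i - ∑ l ∈ S, W i l * d l * (A l / P l t))) := by
        refine Finset.sum_le_sum fun i hi => max_le_max le_rfl ?_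
        have := hk (W i) fun l _ => hW0 i l
        rw [hbold i hi, hmu i hi]
        simp only [hFdef]
        linarith
      rw [hL] at hdev
      linarith
  obtain ⟨lam, ⟨hlo, hhi⟩, hlam⟩ := exists_nonneg_of_forall_dual
    (fun i => if b ∈ B i ∧ 0 < p i then 1 else 0)
    (fun l => if b ∈ B l then -γ b l else 0)
    (fun i l => if b ∈ B l then (if i = l then A l else 0) - (if b ∈ B i then W i l else 0) else 0)
    (by
      intro d hd
      set H : Fin N → ℝ := fun i => A i * d i - ∑ l ∈ S, W i l * d l with hH
      refine ⟨fun i => if 0 < p i ∨ 0 ≤ H i then 1 else 0, ⟨fun i => ?_, fun i => ?_⟩, ?_⟩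
      · simp only
        split_ifs with h1 h2 h2
        · exact le_rfl
        · exact absurd (Or.inl h1.2) h2
        · exact zero_le_one
        · exact le_rfl
      · simp only [Pi.one_apply]
        split_ifs <;> norm_num
      · have key : ∀ y : Fin N → ℝ, ∑ l, d l * ((if b ∈ B l then -γ b l else 0) +
            ∑ i, y i * (if b ∈ B l then (if i = l then A l else 0) -
              (if b ∈ B i then W i l else 0) else 0)) =
            -(∑ l ∈ S, γ b l * d l) + ∑ i ∈ S, y i * H i := by
          intro y
          have h1 : ∀ l, d l * ((if b ∈ B l then -γ b l else 0) +
            ∑ i, y i * (if b ∈ B l then (if i = l then A l else 0) -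
              (if b ∈ B i then W i l else 0) else 0)) = if b ∈ B l then
              -(γ b l * d l) + y l * (A l * d l) - ∑ i ∈ S, y i * (W i l * d l) else 0 := by
            intro l
            split_ifs with hl
            · simp only [mul_sub, Finset.sum_sub_distrib, mul_ite, mul_zero,
                Finset.sum_ite_eq', Finset.mem_univ, if_true, ← Finset.sum_filter]
              have : ∑ i ∈ S, y i * (W i l * d l) = d l * ∑ i ∈ S, y i * W i l := by
                rw [Finset.mul_sum]
                exact Finset.sum_congr rfl fun i _ => by ring
              rw [this]
              simp only [hS, Sagg]
              ring
            · simp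
          simp only [h1, ← Finset.sum_filter]
          change ∑ l ∈ S, _ = _
          simp only [hH, mul_sub, Finset.sum_sub_distrib, Finset.sum_add_distrib,
            Finset.sum_neg_distrib, Finset.mul_sum]
          rw [Finset.sum_comm (s := S) (t := S)]
          ring
        rw [key]
        refine (hdual d hd).trans_eq ?_
        congr 1
        refine Finset.sum_congr rfl fun i _ => ?_
        by_cases h1 : 0 < p i
        · simp [h1, hH]
        · by_cases h2 : 0 ≤ H i
          · simp only [h1, h2, if_false, or_true, if_true, one_mul]
            exact max_eq_right h2
          · simp only [h1, h2, if_false, or_false, zero_mul]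
            exact max_eq_left (not_le.1 h2).le)
  refine ⟨lam, fun i => ⟨?_, hhi i⟩, fun i hi hpi => le_antisymm (hhi i) ?_, fun l hl => ?_⟩
  · refine le_trans ?_ (hlo i)
    simp only
    split_ifs <;> norm_num
  · have := hlo i
    simp only at this
    rwa [if_pos ⟨hi, hpi⟩] at this
  · have := hlam l
    simp only [if_pos hl, mul_sub, Finset.sum_sub_distrib, mul_ite, mul_zero,
      Finset.sum_ite_eq', Finset.mem_univ, if_true, ← Finset.sum_filter] at this
    simp only [hS, Sagg]
    linarith

/-- A price profile and multipliers satisfying the stationarity conditions, in which every source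
is paid by a single aggregator with unit multiplier, form an equilibrium. -/
lemma isGNEP_of_multipliers (hσ : ∀ s, SigmaOK (σ s))
    (hμ : ∀ s, ∀ a : ℝ, 0 < a →
      UniqueMaxOn (fun e => -a * σ s e ^ 2 - e) (Set.Ici 0) (μ s a))
    (hγ : ∀ b s, b ∈ B s → 0 < γ b s)
    (hΓ : ∀ s, alow (σ s) ≤ ∑ j ∈ B s, γ j s)
    {lam : Fin M → Fin N → ℝ} (hlam : ∀ b s, b ∈ B s → 0 < lam b s ∧ lam b s ≤ 1)
    {π : Fin N → Fin M} (hπ : ∀ s, π s ∈ B s ∧ lam (π s) s = 1)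
    (haγ : ∀ b s, b ∈ B s → γ b s ≤ a b s) (hoff : ∀ b s, b ∉ B s → a b s = 0)
    (hE : ∀ b l, b ∈ B l → lam b l * boldAP B a l =
      γ b l + ∑ i ∈ Sagg B b, lam b i * crossWeight ξ B a b i l) :
    IsGNEP σ μ ξ γ B (fun s => Set.Ici (alow (σ s)))
      (fun b i => if b ∈ B i then
        qbP σ μ ξ B a b i + (if b = π i then μ i (boldAP B a i) else 0) else 0) a := by
  set e : Fin N → ℝ := fun i => μ i (boldAP B a i) with he
  set c : Fin M → Fin N → ℝ := fun b i => if b ∈ B i then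
        qbP σ μ ξ B a b i + (if b = π i then e i else 0) else 0 with hc
  have hlow : ∀ s, alow (σ s) ≤ boldAP B a s := fun s =>
    (hΓ s).trans (Finset.sum_le_sum fun j hj => haγ j s hj)
  have hpos : ∀ s, 0 < boldAP B a s := fun s => (hσ s).alow_pos_s17.trans_le (hlow s)
  have he0 : ∀ s, 0 ≤ e s := fun s => (hμ s _ (hpos s)).1
  have hpay : ∀ b i, b ∈ B i → c b i - qbP σ μ ξ B a b i = if b = π i then e i else 0 := by
    intro b i hb
    simp only [hc, if_pos hb, add_sub_cancel_left]
  refine ⟨fun b => ⟨fun s hs => ⟨(hγ b s hs).le.trans (haγ b s hs), hlow s, ?_, ?_⟩,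
    fun s hs => ⟨hoff b s hs, by simp only [hc, if_neg hs]⟩⟩, fun b c' x hfeas => ?_⟩
  · rw [Finset.sum_congr rfl fun j hj => hpay j s hj, Finset.sum_ite_eq', if_pos (hπ s).1]
  · rw [hpay b s hs]
    split_ifs
    · exact he0 s
    · exact le_rfl
  set a' := Function.update a b x with ha'
  set V : Fin N → ℝ := fun l => VvalP σ μ B a l with hV
  set V' : Fin N → ℝ := fun l => VvalP σ μ B a' l with hV'
  set e' : Fin N → ℝ := fun l => μ l (boldAP B a' l) with he'
  set S := Sagg B b with hS
  set W : Fin N → Fin N → ℝ := fun i l => crossWeight ξ B a b i l with hW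
  have hVoff : ∀ l, l ∉ S → V' l = V l := fun l hl =>
    VvalP_update_of_notMem (fun h => hl (mem_Sagg.2 h)) x
  have hsum : ∀ k : Fin N → ℝ,
      ∑ l, k l * V' l - ∑ l, k l * V l = ∑ l ∈ S, k l * (V' l - V l) := by
    intro k
    rw [← Finset.sum_sub_distrib, ← Finset.sum_subset (Finset.subset_univ S)
      (fun l _ hl => by rw [hVoff l hl, sub_self])]
    exact Finset.sum_congr rfl fun l _ => by ring
  have hpi : ∀ i ∈ S, lam b i * (e' i - e i + ∑ l ∈ S, W i l * (V' l - V l)) ≤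
      (c' i - qbP σ μ ξ B a' b i) - (c b i - qbP σ μ ξ B a b i) := by
    intro i hi
    have hb := mem_Sagg.1 hi
    obtain ⟨-, -, h3, h4⟩ := hfeas.1 i hb
    rw [← Finset.add_sum_erase _ _ hb, Function.update_self, Finset.sum_sub_distrib,
      sum_erase_qbP i (fun j hj => Function.update_of_ne hj x a)] at h3
    rw [Function.update_self] at h4
    have h5 : ∑ j ∈ (B i).erase b, Function.update c b c' j i =
        ∑ l, W i l * V l + if b = π i then 0 else e i := by
      have h6 : ∑ j ∈ (B i).erase b, Function.update c b c' j i =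
          ∑ j ∈ (B i).erase b, (qbP σ μ ξ B a j i + if j = π i then e i else 0) := by
        refine Finset.sum_congr rfl fun j hj => ?_
        rw [Function.update_of_ne (Finset.ne_of_mem_erase hj)]
        simp only [hc, if_pos (Finset.mem_of_mem_erase hj)]
      rw [h6, Finset.sum_add_distrib, sum_erase_qbP i (fun _ _ => rfl), Finset.sum_ite_eq']
      congr 1
      by_cases hbp : b = π i
      · simp [hbp]
      · rw [if_pos (Finset.mem_erase.2 ⟨Ne.symm hbp, (hπ i).1⟩), if_neg hbp]
    rw [h5] at h3
    have h6 := hsum (W i)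
    have h7 : e' i - (if b = π i then 0 else e i) + ∑ l ∈ S, W i l * (V' l - V l) ≤
        c' i - qbP σ μ ξ B a' b i := by
      simp only [he', hV, hV', hW, ha'] at h3 h6 ⊢
      linarith
    rw [hpay b i hb]
    by_cases hbp : b = π i
    · rw [if_pos hbp] at h7 ⊢
      have : lam b i = 1 := hbp ▸ (hπ i).2
      rw [this]
      linarith
    · rw [if_neg hbp] at h7 ⊢
      obtain ⟨hl0, hl1⟩ := hlam b i hb
      rw [sub_zero]
      calc _ ≤ lam b i * (c' i - qbP σ μ ξ B a' b i) := mul_le_mul_of_nonneg_left h7 hl0.le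
        _ ≤ 1 * (c' i - qbP σ μ ξ B a' b i) := mul_le_mul_of_nonneg_right hl1 h4
        _ = _ := one_mul _
  have hL : LaggP σ μ ξ γ B c a b =
      ∑ l, γ b l * V l + ∑ i ∈ S, (c b i - qbP σ μ ξ B a b i) := rfl
  have hL' : LaggP σ μ ξ γ B (Function.update c b c') a' b =
      ∑ l, γ b l * V' l + ∑ i ∈ S, (c' i - qbP σ μ ξ B a' b i) := by
    simp only [LaggP, Function.update_self]
    rfl
  have hmain : 0 ≤ ∑ l ∈ S, γ b l * (V' l - V l) +
      ∑ i ∈ S, lam b i * (e' i - e i + ∑ l ∈ S, W i l * (V' l - V l)) := by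
    have h1 : ∑ l ∈ S, γ b l * (V' l - V l) +
        ∑ i ∈ S, lam b i * (e' i - e i + ∑ l ∈ S, W i l * (V' l - V l)) =
        ∑ l ∈ S, lam b l * (boldAP B a l * (V' l - V l) + (e' l - e l)) := by
      have h2 : ∀ l ∈ S, lam b l * (boldAP B a l * (V' l - V l) + (e' l - e l)) =
          γ b l * (V' l - V l) + lam b l * (e' l - e l) +
            ∑ i ∈ S, lam b i * (W i l * (V' l - V l)) := by
        intro l hl
        have h3 : ∑ i ∈ S, lam b i * (W i l * (V' l - V l)) =
            (∑ i ∈ S, lam b i * W i l) * (V' l - V l) := by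
          rw [Finset.sum_mul]
          exact Finset.sum_congr rfl fun i _ => by ring
        rw [h3]
        linear_combination (V' l - V l) * hE b l (mem_Sagg.1 hl)
      rw [Finset.sum_congr rfl h2]
      simp only [mul_add, Finset.sum_add_distrib, Finset.mul_sum]
      rw [Finset.sum_comm (s := S) (t := S)]
      ring
    rw [h1]
    refine Finset.sum_nonneg fun l hl => mul_nonneg (hlam b l (mem_Sagg.1 hl)).1.le ?_
    have hfl := (hfeas.1 l (mem_Sagg.1 hl)).2.1
    have h2 := (hμ l _ (hpos l)).2.1 (e' l)
      (hμ l _ ((hσ l).alow_pos_s17.trans_le hfl)).1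
    simp only [hV, hV', VvalP, he, he'] at h2 ⊢
    linarith
  have h1 := Finset.sum_le_sum hpi
  have h2 := hsum (γ b)
  rw [Finset.sum_sub_distrib] at h1
  rw [hL, hL']
  linarith

/-- A monotone map on the nonnegative elements with a supersolution has a fixed point. -/
lemma exists_fixed_of_supersolution {E : Type*} [ConditionallyCompleteLattice E] [Zero E]
    (T : E → E) (hmono : ∀ a a', 0 ≤ a → a ≤ a' → T a ≤ T a') (h0 : ∀ a, 0 ≤ a → 0 ≤ T a)
    {a₀ : E} (ha₀ : 0 ≤ a₀) (hT : T a₀ ≤ a₀) : ∃ a, 0 ≤ a ∧ T a = a := by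
  set U : Set E := {a | 0 ≤ a ∧ T a ≤ a} with hU
  have hne : U.Nonempty := ⟨a₀, ha₀, hT⟩
  have hbdd : BddBelow U := ⟨0, fun a ha => ha.1⟩
  have hi0 : 0 ≤ sInf U := le_csInf hne fun a ha => ha.1
  have h1 : T (sInf U) ≤ sInf U :=
    le_csInf hne fun a ha => (hmono _ _ hi0 (csInf_le hbdd ha)).trans ha.2
  exact ⟨sInf U, hi0, le_antisymm h1 (csInf_le hbdd ⟨h0 _ hi0, hmono _ _ (h0 _ hi0) h1⟩)⟩

/-- The stationarity inequalities can be turned into equalities. -/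
lemma exists_stationary (hξ0 : ∀ b i l, b ∈ B i → b ∈ B l → 0 ≤ ξ b i l)
    (hγ : ∀ b s, b ∈ B s → 0 < γ b s)
    {lam : Fin M → Fin N → ℝ} (hlam : ∀ b s, b ∈ B s → 0 < lam b s) (ha : 0 ≤ a)
    (hsup : ∀ b l, b ∈ B l → γ b l +
      ∑ i ∈ (Sagg B b).erase l, lam b i * crossWeight ξ B a b i l ≤ lam b l * a b l) :
    ∃ x : Fin M → Fin N → ℝ, 0 ≤ x ∧ (∀ b l, b ∉ B l → x b l = 0) ∧
      ∀ b l, b ∈ B l → lam b l * x b l =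
        γ b l + ∑ i ∈ (Sagg B b).erase l, lam b i * crossWeight ξ B x b i l := by
  obtain ⟨x, hx0, hx⟩ := exists_fixed_of_supersolution
    (fun (y : Fin M → Fin N → ℝ) b l => if b ∈ B l then (γ b l +
      ∑ i ∈ (Sagg B b).erase l, lam b i * crossWeight ξ B y b i l) / lam b l else 0)
    (fun y y' _ hyy b l => by
      simp only
      split_ifs with hb
      · refine div_le_div_of_nonneg_right (add_le_add_right (Finset.sum_le_sum fun i hi => ?_) _)
          (hlam b l hb).le
        exact mul_le_mul_of_nonneg_left (crossWeight_mono hξ0 hyy b i l)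
          (hlam b i (mem_Sagg.1 (Finset.mem_of_mem_erase hi))).le
      · exact le_rfl)
    (fun y hy b l => by
      simp only [Pi.zero_apply]
      split_ifs with hb
      · refine div_nonneg (add_nonneg (hγ b l hb).le (Finset.sum_nonneg fun i hi => ?_))
          (hlam b l hb).le
        exact mul_nonneg (hlam b i (mem_Sagg.1 (Finset.mem_of_mem_erase hi))).le
          (crossWeight_nonneg hξ0 (fun b i _ => hy b i) b i l)
      · exact le_rfl)
    ha (fun b l => by
      simp only
      split_ifs with hb
      · rw [div_le_iff₀ (hlam b l hb), mul_comm (a b l)]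
        exact hsup b l hb
      · exact ha b l)
  refine ⟨x, hx0, fun b l hb => ?_, fun b l hb => ?_⟩
  · have := congr_fun (congr_fun hx b) l
    simp only [if_neg hb] at this
    exact this.symm
  · have := congr_fun (congr_fun hx b) l
    simp only [if_pos hb] at this
    rw [div_eq_iff (hlam b l hb).ne'] at this
    linarith

lemma sum_crossWeight_eq (hξ1 : ∀ b i, b ∈ B i → ξ b i i = 1) {b : Fin M} {l : Fin N}
    (hb : b ∈ B l) (lam : Fin N → ℝ) :
    ∑ i ∈ Sagg B b, lam i * crossWeight ξ B a b i l =
      lam l * (boldAP B a l - a b l) +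
        ∑ i ∈ (Sagg B b).erase l, lam i * crossWeight ξ B a b i l := by
  rw [← Finset.add_sum_erase _ _ (mem_Sagg.2 hb), crossWeight_self hξ1, boldAP_eq hb,
    add_sub_cancel_left]

/-- With exclusive data sources, an equilibrium is determined by `γ`. -/
lemma IsGNEP.eq_of_card_eq_one (hσ : ∀ s, SigmaOK (σ s))
    (hμ : ∀ s, ∀ a : ℝ, 0 < a →
      UniqueMaxOn (fun e => -a * σ s e ^ 2 - e) (Set.Ici 0) (μ s a))
    (hγ : ∀ b s, b ∈ B s → 0 < γ b s)
    (hΓ : ∀ s, alow (σ s) ≤ ∑ j ∈ B s, γ j s) (hcard : ∀ s, (B s).card = 1)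
    (hG : IsGNEP σ μ ξ γ B (fun s => Set.Ici (alow (σ s))) c a) {b : Fin M} {s : Fin N}
    (hs : b ∈ B s) :
    a b s = γ b s ∧ c b s = qbP σ μ ξ B a b s + μ s (γ b s) := by
  have hBb : ∀ i, b ∈ B i → B i = {b} := fun i hi => by
    obtain ⟨b', hb'⟩ := Finset.card_eq_one.1 (hcard i)
    rw [hb', Finset.mem_singleton] at hi
    rw [hb', hi]
  have her : ∀ i, b ∈ B i → (B i).erase b = ∅ := fun i hi => by rw [hBb i hi]; simp
  have hbold : ∀ i, b ∈ B i → boldAP B a i = a b i := fun i hi => by simp [boldAP, hBb i hi]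
  have hγlow : ∀ i, b ∈ B i → alow (σ i) ≤ γ b i := fun i hi => by
    simpa [hBb i hi] using hΓ i
  have halow : ∀ i, b ∈ B i → alow (σ i) ≤ a b i := fun i hi =>
    hbold i hi ▸ ((hG.1 b).1 i hi).2.1
  set x : Fin N → ℝ := fun i => if b ∈ B i then γ b i else 0 with hx
  have hbold' : ∀ i, b ∈ B i → boldAP B (Function.update a b x) i = γ b i := fun i hi => by
    rw [boldAP_update hi, her i hi]
    simp [hx, hi]
  have hdev := hG.le_of_deviation b x
    (fun i hi => ⟨by simp only [hx, if_pos hi]; exact (hγ b i hi).le,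
      by rw [hbold' i hi]; exact hγlow i hi⟩)
    (fun i hi => by simp only [hx, if_neg hi])
  have hpay : ∀ i ∈ Sagg B b, max 0 (μ i (boldAP B (Function.update a b x) i) -
        ∑ j ∈ (B i).erase b, c j i +
        ∑ l, crossWeight ξ B a b i l * VvalP σ μ B (Function.update a b x) l) =
        μ i (γ b i) := by
    intro i hi
    have hb := mem_Sagg.1 hi
    have : ∀ l, crossWeight ξ B a b i l = 0 := fun l => by simp [crossWeight, her i hb]
    simp only [this, zero_mul, Finset.sum_const_zero, her i hb, Finset.sum_empty, sub_zero,
      add_zero, hbold' i hb]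
    exact max_eq_right (hμ i _ (hγ b i hb)).1
  rw [Finset.sum_congr rfl hpay] at hdev
  have hsplit : ∀ v : Fin N → ℝ, ∑ i, γ b i * v i =
      ∑ i ∈ Sagg B b, γ b i * v i + ∑ i ∈ (Sagg B b)ᶜ, γ b i * v i := fun v =>
    (Finset.sum_add_sum_compl _ _).symm
  have hcompl : ∑ i ∈ (Sagg B b)ᶜ, γ b i * VvalP σ μ B (Function.update a b x) i =
      ∑ i ∈ (Sagg B b)ᶜ, γ b i * VvalP σ μ B a i :=
    Finset.sum_congr rfl fun i hi => by
      rw [VvalP_update_of_notMem (fun h => Finset.mem_compl.1 hi (mem_Sagg.2 h))]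
  rw [hsplit, hcompl, LaggP, hsplit] at hdev
  have hon : ∀ i ∈ Sagg B b, γ b i * VvalP σ μ B (Function.update a b x) i + μ i (γ b i) =
      γ b i * σ i (μ i (γ b i)) ^ 2 + μ i (γ b i) := fun i hi => by
    rw [VvalP, hbold' i (mem_Sagg.1 hi)]
  have hopt : ∀ i ∈ Sagg B b, γ b i * σ i (μ i (γ b i)) ^ 2 + μ i (γ b i) ≤
      γ b i * VvalP σ μ B a i + μ i (a b i) := fun i hi => by
    have hb := mem_Sagg.1 hi
    have := (hμ i _ (hγ b i hb)).2.1 _ (hμ i _ ((hσ i).alow_pos_s17.trans_le (halow i hb))).1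
    simp only [VvalP, hbold i hb] at this ⊢
    linarith
  have hIR : ∀ i ∈ Sagg B b, μ i (a b i) ≤ c b i - qbP σ μ ξ B a b i := fun i hi => by
    have hb := mem_Sagg.1 hi
    have := ((hG.1 b).1 i hb).2.2.1
    rwa [hbold i hb, ← Finset.add_sum_erase _ _ hb, her i hb, Finset.sum_empty, add_zero] at this
  have hle : ∀ i ∈ Sagg B b, γ b i * σ i (μ i (γ b i)) ^ 2 + μ i (γ b i) ≤
      γ b i * VvalP σ μ B a i + (c b i - qbP σ μ ξ B a b i) := fun i hi => by
    linarith [hopt i hi, hIR i hi]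
  have hge : ∑ i ∈ Sagg B b, (γ b i * VvalP σ μ B a i + (c b i - qbP σ μ ξ B a b i)) ≤
      ∑ i ∈ Sagg B b, (γ b i * σ i (μ i (γ b i)) ^ 2 + μ i (γ b i)) := by
    rw [← Finset.sum_congr rfl hon, Finset.sum_add_distrib, Finset.sum_add_distrib]
    simp only [qbP]
    linarith
  have hs' := mem_Sagg.2 hs
  have heq := (Finset.sum_eq_sum_iff_of_le hle).1 (le_antisymm (Finset.sum_le_sum hle) hge) s hs'
  have h1 := hopt s hs'
  have h2 := hIR s hs'
  have ha0 := (hσ s).alow_pos_s17.trans_le (halow s hs)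
  have hmu : μ s (a b s) = μ s (γ b s) := by
    refine (hμ s _ (hγ b s hs)).2.2 _ (hμ s _ ha0).1 fun e he => ?_
    have h3 := (hμ s _ (hγ b s hs)).2.1 e he
    simp only [VvalP, hbold s hs] at heq h1 h3 ⊢
    linarith
  refine ⟨?_, by linarith⟩
  rw [← (hσ s).priceOf_of_uniqueMax (halow s hs) (hμ s _ ha0), hmu]
  exact (hσ s).priceOf_of_uniqueMax (hγlow s hs) (hμ s _ (hγ b s hs))

end Game

theorem stmt_17 (N M : ℕ) (hN : 1 ≤ N) (hM : 1 ≤ M)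
    (σ μ : Fin N → ℝ → ℝ) (ξ : Fin M → Fin N → Fin N → ℝ) (γ : Fin M → Fin N → ℝ)
    (B : Fin N → Finset (Fin M)) (hB : ∀ s, (B s).Nonempty)
    (hσ : ∀ s, SigmaOK (σ s))
    (hμ : ∀ s, ∀ a : ℝ, 0 < a →
      UniqueMaxOn (fun e => -a * σ s e ^ 2 - e) (Set.Ici 0) (μ s a))
    (hξ0 : ∀ b i l, b ∈ B i → b ∈ B l → 0 ≤ ξ b i l)
    (hξ1 : ∀ b i, b ∈ B i → ξ b i i = 1)
    (hγ : ∀ b s, b ∈ B s → 0 < γ b s)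
    (hΓ : ∀ s, alow (σ s) ≤ ∑ j ∈ B s, γ j s)
    (cbar abar : Fin M → Fin N → ℝ)
    (hGNE : IsGNEP σ μ ξ γ B (fun s => Set.Ici (alow (σ s))) cbar abar) :
    ((∀ s, (B s).card = 1) →
      ∀ c a : Fin M → Fin N → ℝ,
        IsGNEP σ μ ξ γ B (fun s => Set.Ici (alow (σ s))) c a →
        c = cbar ∧ a = abar) ∧
    ((∃ s, 2 ≤ (B s).card) →
      {p : (Fin M → Fin N → ℝ) × (Fin M → Fin N → ℝ) |
        IsGNEP σ μ ξ γ B (fun s => Set.Ici (alow (σ s))) p.1 p.2}.Infinite) := by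
  refine ⟨fun hcard c a h => ?_, ?_⟩
  · have ha : a = abar := by
      ext b s
      by_cases hs : b ∈ B s
      · rw [(h.eq_of_card_eq_one hσ hμ hγ hΓ hcard hs).1,
          (hGNE.eq_of_card_eq_one hσ hμ hγ hΓ hcard hs).1]
      · rw [((h.1 b).2 s hs).1, ((hGNE.1 b).2 s hs).1]
    refine ⟨?_, ha⟩
    ext b s
    by_cases hs : b ∈ B s
    · rw [(h.eq_of_card_eq_one hσ hμ hγ hΓ hcard hs).2,
        (hGNE.eq_of_card_eq_one hσ hμ hγ hΓ hcard hs).2, ha]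
    · rw [((h.1 b).2 s hs).2, ((hGNE.1 b).2 s hs).2]
  rintro ⟨s₀, hs₀⟩
  choose lam hbd hone hstat using fun b => hGNE.exists_multiplier hσ hμ hξ0 hγ b
  have ha0 : ∀ b s, b ∈ B s → 0 ≤ abar b s := fun b s hb => ((hGNE.1 b).1 s hb).1
  have ha0' : 0 ≤ abar := fun b s => by
    by_cases hb : b ∈ B s
    · exact ha0 b s hb
    · exact (((hGNE.1 b).2 s hb).1).ge
  have hsup : ∀ b l, b ∈ B l → γ b l +
      ∑ i ∈ (Sagg B b).erase l, lam b i * crossWeight ξ B abar b i l ≤ lam b l * abar b l := by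
    intro b l hb
    have := hstat b l hb
    rw [sum_crossWeight_eq hξ1 hb] at this
    linarith
  have hcross : ∀ b l, 0 ≤ ∑ i ∈ (Sagg B b).erase l, lam b i * crossWeight ξ B abar b i l :=
    fun b l => Finset.sum_nonneg fun i _ =>
      mul_nonneg (hbd b i).1 (crossWeight_nonneg hξ0 ha0 b i l)
  have hlamγ : ∀ b s, b ∈ B s → γ b s ≤ lam b s * abar b s := fun b s hb => by
    linarith [hsup b s hb, hcross b s]
  have hγa : ∀ b s, b ∈ B s → γ b s ≤ abar b s := fun b s hb =>
    (hlamγ b s hb).trans (mul_le_of_le_one_left (ha0 b s hb) (hbd b s).2)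
  have hlam0 : ∀ b s, b ∈ B s → 0 < lam b s := fun b s hb =>
    pos_of_mul_pos_left ((hγ b s hb).trans_le (hlamγ b s hb)) (ha0 b s hb)
  have hpayer : ∀ s, ∃ b, b ∈ B s ∧ lam b s = 1 := by
    intro s
    obtain ⟨b₁, hb₁⟩ := hB s
    obtain ⟨-, hlow, hIR, -⟩ := (hGNE.1 b₁).1 s hb₁
    have hpos := (hσ s).alow_pos_s17.trans_le hlow
    have hmu0 : 0 ≤ μ s (boldAP B abar s) := (hμ s _ hpos).1
    rcases hmu0.eq_or_lt with h0 | h0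
    · have hp := (hσ s).priceOf_of_uniqueMax hlow (hμ s _ hpos)
      rw [← h0] at hp
      have hle : ∑ j ∈ B s, abar j s ≤ ∑ j ∈ B s, γ j s := (hp.symm.le).trans (hΓ s)
      have heq := (Finset.sum_eq_sum_iff_of_le fun j hj => hγa j s hj).1
        (le_antisymm (Finset.sum_le_sum fun j hj => hγa j s hj) hle) b₁ hb₁
      refine ⟨b₁, hb₁, le_antisymm (hbd b₁ s).2 ?_⟩
      have h1 := hlamγ b₁ s hb₁
      have h2 := hγ b₁ s hb₁
      rw [← heq] at h1
      exact le_of_mul_le_mul_right (by linarith) h2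
    · obtain ⟨b, hb, hpb⟩ := Finset.exists_lt_of_sum_lt (s := B s) (f := fun _ => (0:ℝ))
        (g := fun j => cbar j s - qbP σ μ ξ B abar j s)
        (by rw [Finset.sum_const_zero]; exact h0.trans_le hIR)
      exact ⟨b, hb, hone b s hb hpb⟩
  choose π hπB hπ1 using hpayer
  obtain ⟨b₀, hb₀, hb₀π⟩ := Finset.exists_mem_ne hs₀ (π s₀)
  have hapos : 0 < abar b₀ s₀ := (hγ b₀ s₀ hb₀).trans_le (hγa b₀ s₀ hb₀)
  set T : ℝ := γ b₀ s₀ / (2 * abar b₀ s₀) with hT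
  have hTpos : 0 < T := div_pos (hγ b₀ s₀ hb₀) (by linarith)
  have hTa : 2 * (T * abar b₀ s₀) = γ b₀ s₀ := by rw [hT]; field_simp
  have hTlam : T < lam b₀ s₀ := by
    have h1 := hlamγ b₀ s₀ hb₀
    have h2 : T * abar b₀ s₀ < lam b₀ s₀ * abar b₀ s₀ := by
      linarith [mul_pos hTpos hapos]
    exact lt_of_mul_lt_mul_right h2 hapos.le
  set L : ℝ → Fin M → Fin N → ℝ := fun t b s =>
    if b = b₀ ∧ s = s₀ then lam b s - t else lam b s with hL
  have hL_le : ∀ t ∈ Set.Icc 0 T, ∀ b s, L t b s ≤ lam b s := by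
    intro t ht b s
    simp only [hL]
    split_ifs
    · linarith [ht.1]
    · exact le_rfl
  have hLpos : ∀ t ∈ Set.Icc 0 T, ∀ b s, b ∈ B s → 0 < L t b s := by
    intro t ht b s hb
    simp only [hL]
    split_ifs with h
    · rw [h.1, h.2]
      linarith [ht.2]
    · exact hlam0 b s hb
  have hex : ∀ t ∈ Set.Icc 0 T, ∃ x : Fin M → Fin N → ℝ, 0 ≤ x ∧
      (∀ b l, b ∉ B l → x b l = 0) ∧ ∀ b l, b ∈ B l → L t b l * x b l =
        γ b l + ∑ i ∈ (Sagg B b).erase l, L t b i * crossWeight ξ B x b i l := by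
    intro t ht
    refine exists_stationary (a := fun b s => 2 * abar b s) hξ0 hγ (hLpos t ht)
      (fun b s => mul_nonneg zero_le_two (ha0' b s)) fun b l hb => ?_
    have h1 : ∑ i ∈ (Sagg B b).erase l, L t b i *
        crossWeight ξ B (fun b s => 2 * abar b s) b i l ≤
        2 * ∑ i ∈ (Sagg B b).erase l, lam b i * crossWeight ξ B abar b i l := by
      rw [Finset.mul_sum]
      refine Finset.sum_le_sum fun i _ => ?_
      have h2 : crossWeight ξ B (fun b s => 2 * abar b s) b i l =
          2 * crossWeight ξ B abar b i l := by
        simp only [crossWeight, Finset.mul_sum, mul_assoc]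
      have h3 := crossWeight_nonneg hξ0 ha0 b i l
      rw [h2]
      nlinarith [hL_le t ht b i]
    have h2 := hsup b l hb
    have h3 := hγ b l hb
    have h4 : 2 * (lam b l * abar b l) - γ b l ≤ L t b l * (2 * abar b l) := by
      simp only [hL]
      split_ifs with h
      · rw [h.1, h.2]
        have := mul_le_mul_of_nonneg_right ht.2 hapos.le
        linarith
      · linarith
    linarith
  choose! x hx0 hxoff hxE using hex
  have hxγ : ∀ t ∈ Set.Icc 0 T, ∀ b s, b ∈ B s → γ b s ≤ x t b s := by
    intro t ht b s hb
    have h1 : 0 ≤ ∑ i ∈ (Sagg B b).erase s, L t b i * crossWeight ξ B (x t) b i s :=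
      Finset.sum_nonneg fun i hi => mul_nonneg
        (hLpos t ht b i (mem_Sagg.1 (Finset.mem_of_mem_erase hi))).le
        (crossWeight_nonneg hξ0 (fun b i _ => hx0 t ht b i) b i s)
    have h2 := hxE t ht b s hb
    have h3 := mul_le_of_le_one_left (hx0 t ht b s) ((hL_le t ht b s).trans (hbd b s).2)
    linarith
  refine Set.infinite_of_injOn_mapsTo (s := Set.Icc 0 T)
    (f := fun t => (fun b i => if b ∈ B i then qbP σ μ ξ B (x t) b i +
        (if b = π i then μ i (boldAP B (x t) i) else 0) else 0, x t)) ?_ ?_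
    (Set.Icc_infinite hTpos)
  · intro t ht t' ht' heq
    have hxx : x t = x t' := congr_arg Prod.snd heq
    have h1 := hxE t ht b₀ s₀ hb₀
    have h2 := hxE t' ht' b₀ s₀ hb₀
    have h3 : ∑ i ∈ (Sagg B b₀).erase s₀, L t b₀ i * crossWeight ξ B (x t') b₀ i s₀ =
        ∑ i ∈ (Sagg B b₀).erase s₀, L t' b₀ i * crossWeight ξ B (x t') b₀ i s₀ :=
      Finset.sum_congr rfl fun i hi => by
        simp only [hL, Finset.ne_of_mem_erase hi, and_false, if_false]
    rw [hxx, h3, ← h2] at h1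
    have h4 : 0 < x t' b₀ s₀ := (hγ b₀ s₀ hb₀).trans_le (hxγ t' ht' b₀ s₀ hb₀)
    have h5 := mul_right_cancel₀ h4.ne' h1
    simp only [hL, and_self, if_true] at h5
    linarith
  · intro t ht
    refine isGNEP_of_multipliers hσ hμ hγ hΓ (lam := L t)
      (fun b s hb => ⟨hLpos t ht b s hb, (hL_le t ht b s).trans (hbd b s).2⟩)
      (fun s => ⟨hπB s, ?_⟩) (hxγ t ht) (hxoff t ht) fun b l hb => ?_
    · have : ¬(π s = b₀ ∧ s = s₀) := by
        rintro ⟨h1, rfl⟩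
        exact hb₀π h1.symm
      simp only [hL, if_neg this]
      exact hπ1 s
    · rw [sum_crossWeight_eq hξ1 hb]
      linarith [hxE t ht b l hb]
end
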